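/- Let C be a bounded open convex subset of ℝⁿ whose Hilbert metric space (C, d_C) is δ-hyperbolic. Then there exists a constant I(δ) > 0, depending only on δ (and n), such that for every affine plane H ⊂ ℝⁿ with C ∩ H ≠ ∅, the Cheeger constant of the planar Hilbert geometry C ∩ H satisfies I_∞(C ∩ H) ≥ I(δ). -/

import Mathlib

open MeasureTheory Set Filter
open scoped ENNReal NNReal

noncomputable section

/-- Euclidean `n`-space. -/
abbrev Euc (n : ℕ) : Type := EuclideanSpace ℝ (Fin n)

/-- The set of parameters `t` such that `p + t • v` lies in `C`. For `C` open bounded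
convex, `p ∈ C` and `v ≠ 0` this is an open interval `(t⁻, t⁺)` with `t⁻ < 0 < t⁺`;
the points `p + t⁻ • v` and `p + t⁺ • v` are the two intersections of the boundary `∂C`
with the line through `p` directed by `v`. -/
def lineParams {n : ℕ} (C : Set (Euc n)) (p v : Euc n) : Set ℝ := {t : ℝ | p + t • v ∈ C}

open Classical in
/-- The Hilbert distance of the convex set `C`: with `a = p + t⁻ • (q - p)` and
`b = p + t⁺ • (q - p)` the two boundary points (so that `a, p, q, b` are in this order),
the cross-ratio `(‖q-a‖ ‖p-b‖)/(‖p-a‖ ‖q-b‖)` equals `((1 - t⁻) t⁺)/((-t⁻)(t⁺ - 1))`. -/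
def hDist {n : ℕ} (C : Set (Euc n)) (p q : Euc n) : ℝ :=
  if p = q then 0
  else
    (1 / 2) * Real.log
      (((1 - sInf (lineParams C p (q - p))) * sSup (lineParams C p (q - p))) /
        ((-sInf (lineParams C p (q - p))) * (sSup (lineParams C p (q - p)) - 1)))

open Classical in
/-- The Hilbert Finsler norm of `u` at `p`: with `p⁺ = p + t⁺ • u`, `p⁻ = p + t⁻ • u`
the two boundary points on the line through `p` directed by `u`, one has
`(1/2)‖u‖(1/‖p-p⁺‖ + 1/‖p-p⁻‖) = (1/2)(1/t⁺ - 1/t⁻)`. -/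
def fNorm {n : ℕ} (C : Set (Euc n)) (p u : Euc n) : ℝ :=
  if u = 0 then 0
  else (1 / 2) * (1 / sSup (lineParams C p u) - 1 / sInf (lineParams C p u))

/-- The dual norm of a linear form `l` at `p`: `sup {l u : ‖u‖_{C,p} = 1}`. -/
def dualNorm {n : ℕ} (C : Set (Euc n)) (p : Euc n) (l : Euc n →L[ℝ] ℝ) : ℝ :=
  sSup ((fun u => l u) '' {u : Euc n | fNorm C p u = 1})

/-- The tangent ball `TB_R(p) = {u : ‖u‖_{C,p} < R}`. -/
def tangentBall {n : ℕ} (C : Set (Euc n)) (p : Euc n) (R : ℝ) : Set (Euc n) :=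
  {u : Euc n | fNorm C p u < R}

/-- `ωₙ`, the Lebesgue volume of the Euclidean unit ball of `ℝⁿ`. -/
def omegaVol (n : ℕ) : ℝ := (volume (Metric.ball (0 : Euc n) 1)).toReal

/-- The Hilbert (Busemann) measure of `C`: density `ωₙ / vol_e(TB_C(p))` against
Lebesgue measure, supported on `C`. -/
def hMeasure {n : ℕ} (C : Set (Euc n)) : Measure (Euc n) :=
  (volume.restrict C).withDensity fun p =>
    ENNReal.ofReal (omegaVol n / (volume (tangentBall C p 1)).toReal)

/-- Admissible test functions: nonzero Lipschitz functions with compact support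
contained in `Ω`. -/
def testFuns {n : ℕ} (Ω : Set (Euc n)) : Set (Euc n → ℝ) :=
  {f : Euc n → ℝ |
    (∃ K : ℝ≥0, LipschitzWith K f) ∧ f ≠ 0 ∧ HasCompactSupport f ∧ tsupport f ⊆ Ω}

/-- The Rayleigh quotient of `f` on `Ω`, with respect to the Hilbert geometry of `C`
(`df` is the a.e.-defined differential of the Lipschitz function `f`). -/
def rayleigh {n : ℕ} (C Ω : Set (Euc n)) (f : Euc n → ℝ) : ℝ :=
  (∫ p in Ω, dualNorm C p (fderiv ℝ f p) ^ 2 ∂hMeasure C) /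
    ∫ p in Ω, f p ^ 2 ∂hMeasure C

/-- The Dirichlet bottom of the spectrum `λ₁^C(Ω)`. -/
def lambda1D {n : ℕ} (C Ω : Set (Euc n)) : ℝ := sInf (rayleigh C Ω '' testFuns Ω)

/-- The bottom of the spectrum `λ₁(C)` of the Hilbert geometry of `C`. -/
def lambda1 {n : ℕ} (C : Set (Euc n)) : ℝ := lambda1D C C

/-- The Gromov product `(x|y)_t = (d(x,t) + d(y,t) - d(x,y))/2`. -/
def gromovProd {n : ℕ} (d : Euc n → Euc n → ℝ) (x y t : Euc n) : ℝ :=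
  (d x t + d y t - d x y) / 2

/-- `(C, d_C)` is `δ`-hyperbolic: for all `x y z t` in `C`,
`(x|y)_t ≥ min((x|z)_t, (y|z)_t) - δ`. -/
def IsDeltaHyp {n : ℕ} (C : Set (Euc n)) (δ : ℝ) : Prop :=
  ∀ x ∈ C, ∀ y ∈ C, ∀ z ∈ C, ∀ t ∈ C,
    gromovProd (hDist C) x y t ≥
      min (gromovProd (hDist C) x z t) (gromovProd (hDist C) y z t) - δ

/-- The metric ball `B_R(x)` of the Hilbert metric of `C`. -/
def hBall {n : ℕ} (C : Set (Euc n)) (x : Euc n) (R : ℝ) : Set (Euc n) :=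
  {y ∈ C | hDist C x y < R}

/-- The image of `C` under the homothety of center `P₀` and ratio `r`. -/
def homoth {n : ℕ} (P₀ : Euc n) (r : ℝ) (C : Set (Euc n)) : Set (Euc n) :=
  (fun x => P₀ + r • (x - P₀)) '' C

/-- Diameter of a set with respect to a distance function `d`. -/
def ediamD {α : Type*} (d : α → α → ℝ) (S : Set α) : ℝ≥0∞ :=
  ⨆ x ∈ S, ⨆ y ∈ S, ENNReal.ofReal (d x y)

/-- The `k`-dimensional Hausdorff measure of `S` with respect to the distance
function `d`. -/
def hausD {α : Type*} (k : ℝ) (d : α → α → ℝ) (S : Set α) : ℝ≥0∞ :=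
  ⨆ (ε : ℝ≥0∞) (_ : 0 < ε),
    ⨅ (U : ℕ → Set α) (_ : S ⊆ ⋃ i, U i) (_ : ∀ i, ediamD d (U i) ≤ ε),
      ∑' i, ediamD d (U i) ^ k

/-- The frontier of `U` is a rectifiable closed curve (for the Hilbert metric of `C`):
it is the image of a closed continuous curve and has finite one-dimensional Hausdorff
measure. -/
def RectCurveBoundary (C U : Set (Euc 2)) : Prop :=
  ∃ c : ℝ → Euc 2, ContinuousOn c (Icc 0 1) ∧ c '' Icc (0 : ℝ) 1 = frontier U ∧
    c 0 = c 1 ∧ hausD 1 (hDist C) (frontier U) < ⊤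

/-- The Cheeger constant `I_∞^C(Ω)` in dimension `2`: infimum of
`ν_C(∂U)/μ_C(U)` over open sets `U` with closure contained in `Ω` whose boundary is a
rectifiable curve, `ν_C` being the `1`-dimensional Hausdorff measure of `(C, d_C)`. -/
def cheeger2D (C Ω : Set (Euc 2)) : ℝ :=
  sInf {r : ℝ | ∃ U : Set (Euc 2), IsOpen U ∧ U.Nonempty ∧ closure U ⊆ Ω ∧
    RectCurveBoundary C U ∧
    r = (hausD 1 (hDist C) (frontier U)).toReal / (hMeasure C U).toReal}

/-- The Cheeger constant `I_∞(C)` of a planar Hilbert geometry. -/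
def cheeger2 (C : Set (Euc 2)) : ℝ := cheeger2D C C

/-- `S` is a `C¹` hypersurface: near each of its points it is the zero set of a `C¹`
function with nonvanishing differential. -/
def IsC1Hypersurface {n : ℕ} (S : Set (Euc n)) : Prop :=
  ∀ x ∈ S, ∃ (f : Euc n → ℝ) (U : Set (Euc n)), U ∈ nhds x ∧ ContDiffOn ℝ 1 f U ∧
    (∀ y ∈ U, fderiv ℝ f y ≠ 0) ∧ S ∩ U = {y ∈ U | f y = 0}

/-- The Cheeger constant `I_∞^C(Ω)` in dimension `n`: infimum of `ν_C(∂U)/μ_C(U)` over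
open sets `U` with closure contained in `Ω` whose boundary is a `C¹` hypersurface,
`ν_C` being the `(n-1)`-dimensional Hausdorff measure of `(C, d_C)`. -/
def cheegerND {n : ℕ} (C Ω : Set (Euc n)) : ℝ :=
  sInf {r : ℝ | ∃ U : Set (Euc n), IsOpen U ∧ U.Nonempty ∧ closure U ⊆ Ω ∧
    IsC1Hypersurface (frontier U) ∧
    r = (hausD ((n : ℝ) - 1) (hDist C) (frontier U)).toReal / (hMeasure C U).toReal}

/-- The boundary of the convex set `C` is of class `C¹`: through each boundary point
passes a unique supporting hyperplane. -/
def HasC1Boundary {n : ℕ} (C : Set (Euc n)) : Prop :=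
  ∀ x ∈ frontier C, ∃! l : Euc n →L[ℝ] ℝ, ‖l‖ = 1 ∧ ∀ y ∈ C, l y ≤ l x

/-- The convex set `C` is strictly convex: the open segment joining two distinct
boundary points is contained in `C`. -/
def IsStrictlyConvexSet {n : ℕ} (C : Set (Euc n)) : Prop :=
  ∀ x ∈ frontier C, ∀ y ∈ frontier C, x ≠ y → openSegment ℝ x y ⊆ C

end



theorem lp_bdd {n : ℕ} {C : Set (Euc n)} (hb : Bornology.IsBounded C) {p v : Euc n}
    (hv : v ≠ 0) : ∃ M : ℝ, 0 < M ∧ ∀ t ∈ lineParams C p v, |t| ≤ M := by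
  obtain ⟨R, hR⟩ := hb.exists_norm_le
  have hv' : 0 < ‖v‖ := norm_pos_iff.mpr hv
  refine ⟨(|R| + ‖p‖ + 1) / ‖v‖, by positivity, fun t ht => ?_⟩
  rw [le_div_iff₀ hv']
  have h1 := hR _ ht
  have h2 : ‖t • v‖ ≤ ‖p + t • v‖ + ‖p‖ := by
    have := norm_sub_le (p + t • v) p
    simpa using this
  rw [norm_smul, Real.norm_eq_abs] at h2
  have := le_abs_self R
  linarith

theorem lp_open {n : ℕ} {C : Set (Euc n)} (ho : IsOpen C) (p v : Euc n) :
    IsOpen (lineParams C p v) := by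
  have : Continuous fun t : ℝ => p + t • v := by fun_prop
  exact ho.preimage this

theorem lp_convex {n : ℕ} {C : Set (Euc n)} (hc : Convex ℝ C) (p v : Euc n) :
    OrdConnected (lineParams C p v) := by
  rw [← convex_iff_ordConnected]
  intro x hx y hy a b ha hb hab
  have h := hc hx hy ha hb hab
  have e : a • (p + x • v) + b • (p + y • v) = p + (a • x + b • y) • v := by
    have : p = (a + b) • p := by rw [hab, one_smul]
    conv_rhs => rw [this]
    simp only [smul_eq_mul]
    module
  rw [e] at h
  exact h

theorem lp_bddAbove {n : ℕ} {C : Set (Euc n)} (hb : Bornology.IsBounded C) {p v : Euc n}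
    (hv : v ≠ 0) : BddAbove (lineParams C p v) ∧ BddBelow (lineParams C p v) := by
  obtain ⟨M, -, hM⟩ := lp_bdd hb (p := p) hv
  exact ⟨⟨M, fun t ht => (abs_le.mp (hM t ht)).2⟩, ⟨-M, fun t ht => (abs_le.mp (hM t ht)).1⟩⟩

theorem lp_lt_sSup {n : ℕ} {C : Set (Euc n)} (ho : IsOpen C) (hb : Bornology.IsBounded C)
    {p v : Euc n} (hv : v ≠ 0) {t : ℝ} (ht : p + t • v ∈ C) :
    t < sSup (lineParams C p v) ∧ sInf (lineParams C p v) < t := by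
  have hO := lp_open ho p v
  obtain ⟨ε, hε, h⟩ := Metric.isOpen_iff.mp hO t ht
  have h1 : t + ε / 2 ∈ lineParams C p v := h (by
    rw [Metric.mem_ball, Real.dist_eq]; rw [show t + ε / 2 - t = ε / 2 by ring, abs_of_pos] <;> linarith)
  have h2 : t - ε / 2 ∈ lineParams C p v := h (by
    rw [Metric.mem_ball, Real.dist_eq]
    rw [show t - ε / 2 - t = -(ε / 2) by ring, abs_neg, abs_of_pos] <;> linarith)
  obtain ⟨hA, hB⟩ := lp_bddAbove hb (p := p) hv
  have := le_csSup hA h1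
  have := csInf_le hB h2
  constructor <;> linarith

theorem hd_ub {n : ℕ} {C : Set (Euc n)} (ho : IsOpen C) (hb : Bornology.IsBounded C)
    {p q : Euc n} (hpq : p ≠ q) {s s' : ℝ} (hs : 0 < s) (hs' : 0 < s')
    (h1 : p - s • (q - p) ∈ C) (h2 : q + s' • (q - p) ∈ C) :
    hDist C p q ≤ (1 / 2) * Real.log (((1 + s) / s) * ((1 + s') / s')) := by
  have hv : q - p ≠ 0 := sub_ne_zero.mpr (Ne.symm hpq)
  have h1' : p + (-s) • (q - p) ∈ C := by rwa [neg_smul, ← sub_eq_add_neg]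
  have h2' : p + (1 + s') • (q - p) ∈ C := by
    have : p + (1 + s') • (q - p) = q + s' • (q - p) := by module
    rwa [this]
  have a1 := (lp_lt_sSup ho hb hv h1').2
  have a2 := (lp_lt_sSup ho hb hv h2').1
  unfold hDist
  rw [if_neg hpq]
  set T := sSup (lineParams C p (q - p))
  set I := sInf (lineParams C p (q - p))
  have e : (1 - I) * T / (-I * (T - 1)) = ((1 - I) / (-I)) * (T / (T - 1)) := by
    rw [div_mul_div_comm]
  rw [e]
  have b1 : (1 - I) / (-I) ≤ (1 + s) / s := by
    rw [div_le_div_iff₀ (by linarith) hs]; nlinarith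
  have b2 : T / (T - 1) ≤ (1 + s') / s' := by
    rw [div_le_div_iff₀ (by linarith) hs']; nlinarith
  have c1 : 0 < (1 - I) / (-I) := div_pos (by linarith) (by linarith)
  have c2 : 0 < T / (T - 1) := div_pos (by linarith) (by linarith)
  gcongr

theorem hd_lb {n : ℕ} {C : Set (Euc n)} (hc : Convex ℝ C) (ho : IsOpen C)
    (hb : Bornology.IsBounded C)
    {p q : Euc n} (hp : p ∈ C) (hq : q ∈ C) {D s : ℝ} (hs : 0 < s)
    (hD : hDist C p q ≤ D) (h : Real.exp (2 * D) < (1 + s) / s) :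
    p - s • (q - p) ∈ C ∧ q + s • (q - p) ∈ C := by
  by_cases hpq : p = q
  · subst hpq; simp [hp]
  have hv : q - p ≠ 0 := sub_ne_zero.mpr (Ne.symm hpq)
  have h0 : p + (0:ℝ) • (q - p) ∈ C := by simpa
  have h1 : p + (1:ℝ) • (q - p) ∈ C := by simpa
  have a1 := (lp_lt_sSup ho hb hv h0).2
  have a2 := (lp_lt_sSup ho hb hv h1).1
  have hL : Real.exp (2 * D) ≥ ((1 - sInf (lineParams C p (q - p))) / (-sInf (lineParams C p (q - p))))
      * (sSup (lineParams C p (q - p)) / (sSup (lineParams C p (q - p)) - 1)) := by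
    unfold hDist at hD
    rw [if_neg hpq] at hD
    set T := sSup (lineParams C p (q - p))
    set I := sInf (lineParams C p (q - p))
    have e : (1 - I) * T / (-I * (T - 1)) = ((1 - I) / (-I)) * (T / (T - 1)) := by
      rw [div_mul_div_comm]
    rw [e] at hD
    have c1 : 0 < (1 - I) / (-I) := div_pos (by linarith) (by linarith)
    have c2 : 0 < T / (T - 1) := div_pos (by linarith) (by linarith)
    have : Real.log (((1 - I) / (-I)) * (T / (T - 1))) ≤ 2 * D := by linarith
    exact (Real.log_le_iff_le_exp (mul_pos c1 c2)).mp this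
  obtain ⟨hA, hB⟩ := lp_bddAbove hb (p := p) hv
  have hOC := lp_convex hc p (q - p)
  have h0' : (0:ℝ) ∈ lineParams C p (q - p) := h0
  have hne : (lineParams C p (q - p)).Nonempty := ⟨_, h0'⟩
  set T := sSup (lineParams C p (q - p)) with hT
  set I := sInf (lineParams C p (q - p)) with hI
  have d1 : 1 ≤ (1 - I) / (-I) := by rw [le_div_iff₀ (by linarith)]; linarith
  have d2 : 1 ≤ T / (T - 1) := by rw [le_div_iff₀ (by linarith)]; linarith
  have f1 : (1 - I) / (-I) < (1 + s) / s := by nlinarith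
  have f2 : T / (T - 1) < (1 + s) / s := by nlinarith
  rw [div_lt_div_iff₀ (by linarith) hs] at f1 f2
  have g1 : I < -s := by nlinarith
  have g2 : 1 + s < T := by nlinarith
  obtain ⟨t1, ht1, ht1'⟩ := exists_lt_of_csInf_lt hne g1
  obtain ⟨t2, ht2, ht2'⟩ := exists_lt_of_lt_csSup hne g2
  have m1 : -s ∈ lineParams C p (q - p) := hOC.out ht1 h0' ⟨ht1'.le, by linarith⟩
  have m2 : 1 + s ∈ lineParams C p (q - p) := hOC.out h0' ht2 ⟨by linarith, ht2'.le⟩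
  constructor
  · have : p + (-s) • (q - p) ∈ C := m1
    rwa [neg_smul, ← sub_eq_add_neg] at this
  · have : p + (1 + s) • (q - p) ∈ C := m2
    have e : p + (1 + s) • (q - p) = q + s • (q - p) := by module
    rwa [e] at this

theorem fNorm_lt_one {n : ℕ} {C : Set (Euc n)} (ho : IsOpen C) (hb : Bornology.IsBounded C)
    {p v : Euc n} (h1 : p + v ∈ C) (h2 : p - v ∈ C) : fNorm C p v < 1 := by
  unfold fNorm
  split_ifs with h
  · norm_num
  · have a1 := (lp_lt_sSup ho hb h (t := 1) (by simpa using h1)).1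
    have a2 := (lp_lt_sSup ho hb h (t := -1) (by simpa [sub_eq_add_neg] using h2)).2
    set T := sSup (lineParams C p v)
    set I := sInf (lineParams C p v)
    have b1 : 1 / T < 1 := by rw [div_lt_one (by linarith)]; exact a1
    have b2 : -(1 / I) < 1 := by
      rw [← one_div_neg_eq_neg_one_div, div_lt_one (by linarith)]; linarith
    linarith

theorem tb_bdd {n : ℕ} {C : Set (Euc n)} (ho : IsOpen C) {R : ℝ}
    (hR : ∀ x ∈ C, ‖x‖ ≤ R) {p : Euc n} (hp : p ∈ C) :
    tangentBall C p 1 ⊆ Metric.ball 0 (2 * R + 1) := by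
  have hb : Bornology.IsBounded C := isBounded_iff_forall_norm_le.mpr ⟨R, hR⟩
  intro v hv
  have hR0 : 0 ≤ R := (norm_nonneg _).trans (hR p hp)
  have hv1 : fNorm C p v < 1 := hv
  rw [mem_ball_zero_iff]
  by_cases h0 : v = 0
  · subst h0; simp; linarith
  unfold fNorm at hv1
  rw [if_neg h0] at hv1
  have h0' : p + (0:ℝ) • v ∈ C := by simpa
  have a := lp_lt_sSup ho hb h0 h0'
  have hv' : 0 < ‖v‖ := norm_pos_iff.mpr h0
  have key : ∀ t ∈ lineParams C p v, |t| ≤ 2 * R / ‖v‖ := by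
    intro t ht
    rw [le_div_iff₀ hv']
    have h1 := hR _ ht
    have h3 := hR _ hp
    have h2 : ‖t • v‖ ≤ ‖p + t • v‖ + ‖p‖ := by
      have := norm_sub_le (p + t • v) p
      simpa using this
    rw [norm_smul, Real.norm_eq_abs] at h2
    linarith
  have hne : (lineParams C p v).Nonempty := ⟨0, h0'⟩
  have b1 : sSup (lineParams C p v) ≤ 2 * R / ‖v‖ :=
    csSup_le hne fun t ht => (abs_le.mp (key t ht)).2
  have b2 : -(2 * R / ‖v‖) ≤ sInf (lineParams C p v) :=
    le_csInf hne fun t ht => (abs_le.mp (key t ht)).1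
  set T := sSup (lineParams C p v)
  set I := sInf (lineParams C p v)
  have hX : 0 < 2 * R / ‖v‖ := by linarith [a.1]
  have c1 : 1 / (2 * R / ‖v‖) ≤ 1 / T := one_div_le_one_div_of_le a.1 b1
  have c2 : 1 / (2 * R / ‖v‖) ≤ -(1 / I) := by
    rw [← one_div_neg_eq_neg_one_div]
    exact one_div_le_one_div_of_le (by linarith [a.2]) (by linarith)
  have c3 : 1 / (2 * R / ‖v‖) < 1 := by linarith
  rw [div_lt_one hX, lt_div_iff₀ hv'] at c3
  linarith

/-- convex bounded open sets which are centered at the origin -/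
structure Good (C : Set (Euc 2)) : Prop where
  cvx : Convex ℝ C
  opn : IsOpen C
  bdd : Bornology.IsBounded C
  zero : (0 : Euc 2) ∈ C
  cent : ∀ z ∈ C, (-(1/2) : ℝ) • z ∈ C

namespace Good

variable {C : Set (Euc 2)}

theorem nhds0 (hG : Good C) : C ∈ nhds (0 : Euc 2) := hG.opn.mem_nhds hG.zero

theorem gmem (hG : Good C) {z : Euc 2} : gauge C z < 1 ↔ z ∈ C := by
  rw [gauge_lt_one_iff_mem_interior hG.cvx hG.nhds0, hG.opn.interior_eq]

theorem gsmul {a : ℝ} (ha : 0 ≤ a) (z : Euc 2) : gauge C (a • z) = a * gauge C z := by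
  rw [gauge_smul_of_nonneg ha, smul_eq_mul]

theorem gadd (hG : Good C) (x y : Euc 2) : gauge C (x + y) ≤ gauge C x + gauge C y :=
  gauge_add_le hG.cvx (absorbent_nhds_zero hG.nhds0) x y

theorem gpos (hG : Good C) {z : Euc 2} (hz : z ≠ 0) : 0 < gauge C z := by
  rw [gauge_pos (absorbent_nhds_zero hG.nhds0)
    ((NormedSpace.isVonNBounded_iff ℝ).mpr hG.bdd)]
  exact hz

theorem gcont (hG : Good C) : Continuous (gauge C) := continuous_gauge hG.cvx hG.nhds0

theorem gneg (hG : Good C) (z : Euc 2) : gauge C (-z) ≤ 2 * gauge C z := by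
  refine le_of_forall_gt_imp_ge_of_dense fun r hr => ?_
  have h0 : 0 ≤ gauge C z := gauge_nonneg z
  have hr0 : 0 < r := by linarith
  have h1 : (2 / r) • z ∈ C := by
    rw [← hG.gmem, gsmul (by positivity), div_mul_eq_mul_div, div_lt_one hr0]; exact hr
  have h2 := hG.cent _ h1
  have h3 : (-(1/2) : ℝ) • (2 / r) • z = (1 / r) • (-z) := by
    rw [smul_neg, ← neg_smul, smul_smul]; congr 1; field_simp
  rw [h3, ← hG.gmem, gsmul (by positivity), one_div, inv_mul_lt_iff₀ hr0] at h2
  linarith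

theorem star (hG : Good C) {z : Euc 2} (hz : z ∈ C) {x : ℝ} (h0 : 0 ≤ x) (h1 : x ≤ 1) :
    x • z ∈ C := by
  have := hG.cvx hG.zero hz (sub_nonneg.mpr h1) h0 (by ring)
  simpa using this

theorem seg (hG : Good C) {p w : Euc 2} (hp : p ∈ C) (hw : p + w ∈ C) {x : ℝ} (h0 : 0 ≤ x)
    (h1 : x ≤ 1) : p + x • w ∈ C := by
  have := hG.cvx hp hw (sub_nonneg.mpr h1) h0 (by ring)
  have e : (1 - x) • p + x • (p + w) = p + x • w := by module
  rwa [e] at this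

theorem hd0_lb (hG : Good C) {z : Euc 2} (hz : z ∈ C) :
    -Real.log (1 - gauge C z) / 2 ≤ hDist C z 0 := by
  by_cases h : z = 0
  · subst h; simp [hDist, gauge_zero]
  have g1 := hG.gmem.mpr hz
  have g0 := hG.gpos h
  by_contra hcon
  push Not at hcon
  have hs : 0 < (1 - gauge C z) / gauge C z := div_pos (by linarith) g0
  have := (hd_lb hG.cvx hG.opn hG.bdd hz hG.zero (s := (1 - gauge C z) / gauge C z)
    hs le_rfl (by
      have e : (1 + (1 - gauge C z) / gauge C z) / ((1 - gauge C z) / gauge C z)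
        = (1 - gauge C z)⁻¹ := by
        have : 1 - gauge C z ≠ 0 := by linarith
        field_simp; ring
      rw [e, ← Real.lt_log_iff_exp_lt (by positivity), Real.log_inv]
      · linarith)).1
  have e2 : z - ((1 - gauge C z) / gauge C z) • (0 - z) = (gauge C z)⁻¹ • z := by
    have : (gauge C z)⁻¹ = 1 + (1 - gauge C z) / gauge C z := by field_simp; ring
    rw [this]; module
  rw [e2, ← hG.gmem, gsmul (by positivity), inv_mul_cancel₀ g0.ne'] at this
  exact lt_irrefl _ this

theorem hd0_ub (hG : Good C) {z : Euc 2} (hz : z ∈ C) :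
    hDist C z 0 ≤ -Real.log (1 - gauge C z) / 2 + Real.log 6 / 2 := by
  by_cases h : z = 0
  · subst h; simp [hDist, gauge_zero]; positivity
  have g1 := hG.gmem.mpr hz
  have g0 := hG.gpos h
  have hs : 0 < (1 - gauge C z) / (2 * gauge C z) := div_pos (by linarith) (by linarith)
  have := hd_ub hG.opn hG.bdd h hs (s' := 1/2) (by norm_num)
    (by
      have e2 : z - ((1 - gauge C z) / (2 * gauge C z)) • (0 - z)
          = (1 + (1 - gauge C z) / (2 * gauge C z)) • z := by module
      rw [e2, ← hG.gmem, gsmul (by positivity)]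
      have : (1 + (1 - gauge C z) / (2 * gauge C z)) * gauge C z = (1 + gauge C z) / 2 := by
        field_simp; ring
      rw [this]; linarith)
    (by
      have := hG.cent z hz
      have e : (0 : Euc 2) + (1 / 2 : ℝ) • (0 - z) = (-(1/2) : ℝ) • z := by module
      rwa [e])
  refine this.trans ?_
  have e : (1 + (1 - gauge C z) / (2 * gauge C z)) / ((1 - gauge C z) / (2 * gauge C z))
        * ((1 + 1/2) / (1/2)) ≤ (1 - gauge C z)⁻¹ * 6 := by
    have h1 : 0 < 1 - gauge C z := by linarith
    have : (1 + (1 - gauge C z) / (2 * gauge C z)) / ((1 - gauge C z) / (2 * gauge C z))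
        = (1 + gauge C z) * (1 - gauge C z)⁻¹ := by
      field_simp; ring
    rw [this]
    have : 0 < (1 - gauge C z)⁻¹ := by positivity
    nlinarith
  have h1 : 0 < 1 - gauge C z := by linarith
  have := Real.log_le_log (by positivity) e
  rw [Real.log_mul (x := (1 - gauge C z)⁻¹) (by positivity) (by norm_num), Real.log_inv] at this
  linarith

theorem hdl_ub (hG : Good C) {z : Euc 2} (hz : z ∈ C) {l : ℝ} (h0 : 0 < l) (h1 : l < 1) :
    hDist C (l • z) z ≤ -Real.log (1 - gauge C z) / 2 + Real.log (1 - gauge C (l • z)) / 2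
      + Real.log 6 / 2 := by
  by_cases h : z = 0
  · subst h; simp [hDist, gauge_zero]; positivity
  have g1 := hG.gmem.mpr hz
  have g0 := hG.gpos h
  rw [gsmul h0.le]
  have hne : l • z ≠ z := by
    intro e
    have : (l - 1) • z = 0 := by rw [sub_smul, e, one_smul, sub_self]
    rcases smul_eq_zero.mp this with h' | h'
    · linarith
    · exact h h'
  set g := gauge C z with hg
  have hl : 0 < 1 - l := by linarith
  have hg1 : 0 < 1 - g := by linarith
  have := hd_ub hG.opn hG.bdd hne (s := (l + 1/2) / (1 - l)) (s' := (1 - g) / (2 * g * (1 - l)))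
    (by positivity) (by positivity)
    (by
      have := hG.cent z hz
      have e : l • z - ((l + 1/2) / (1 - l)) • (z - l • z) = (-(1/2) : ℝ) • z := by
        have : (-(1/2) : ℝ) = l - ((l + 1/2) / (1 - l)) * (1 - l) := by field_simp; ring
        rw [this]; module
      rwa [e])
    (by
      have e2 : z + ((1 - g) / (2 * g * (1 - l))) • (z - l • z)
          = (1 + (1 - g) / (2 * g)) • z := by
        have : (1 - g) / (2 * g) = ((1 - g) / (2 * g * (1 - l))) * (1 - l) := by field_simp
        rw [this]; module
      rw [e2, ← hG.gmem, gsmul (by positivity), ← hg]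
      have : (1 + (1 - g) / (2 * g)) * g = (1 + g) / 2 := by
        field_simp; ring
      rw [this]; linarith)
  refine this.trans ?_
  have hlg : 0 < 1 - l * g := by nlinarith
  have e : (1 + (l + 1/2) / (1 - l)) / ((l + 1/2) / (1 - l)) *
      ((1 + (1 - g) / (2 * g * (1 - l))) / ((1 - g) / (2 * g * (1 - l)))) ≤
      (1 - g)⁻¹ * (1 - l * g) * 6 := by
    have a1 : (1 + (l + 1/2) / (1 - l)) / ((l + 1/2) / (1 - l)) ≤ 3 := by
      rw [div_le_iff₀ (by positivity), ← sub_nonneg]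
      have : 3 * ((l + 1 / 2) / (1 - l)) - (1 + (l + 1 / 2) / (1 - l)) = (3 * l) / (1 - l) := by
        field_simp; ring
      rw [this]; positivity
    have a2 : (1 + (1 - g) / (2 * g * (1 - l))) / ((1 - g) / (2 * g * (1 - l)))
        ≤ (1 - g)⁻¹ * (1 - l * g) * 2 := by
      have : (1 + (1 - g) / (2 * g * (1 - l))) / ((1 - g) / (2 * g * (1 - l)))
        = (1 - g)⁻¹ * (1 + g - 2 * l * g) := by field_simp; ring
      rw [this]
      have hh : 1 + g - 2 * l * g ≤ (1 - l * g) * 2 := by linarith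
      have hi : 0 ≤ (1 - g)⁻¹ := by positivity
      have := mul_le_mul_of_nonneg_left hh hi
      linarith
    calc _ ≤ 3 * ((1 - g)⁻¹ * (1 - l * g) * 2) := by gcongr
      _ = _ := by ring
  have := Real.log_le_log (by positivity) e
  rw [Real.log_mul (x := (1 - g)⁻¹ * (1 - l * g)) (by positivity) (by norm_num),
    Real.log_mul (x := (1 - g)⁻¹) (by positivity) (by positivity), Real.log_inv] at this
  linarith

end Good

/-- the constant `E` -/
noncomputable def EE (δ : ℝ) : ℝ := 864 * Real.exp (8 * δ)

theorem EE_ge {δ : ℝ} (hδ : 0 ≤ δ) : 864 ≤ EE δ := by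
  unfold EE
  have := Real.one_le_exp (show 0 ≤ 8 * δ by linarith)
  linarith

theorem contr_arith {δ l2 l6 l8 l16 lr La Lb La' Lb' a0 b0 a0' b0' aa bb ab ba ab' : ℝ}
    (h6 : 0 ≤ l6) (h2 : 0 ≤ l2) (hδ : 0 ≤ δ) (h16 : l16 = l2 + l8)
    (A1 : l16 + lr ≤ La') (A2 : La' ≤ l2 + l16 + lr)
    (B1 : l16 + lr ≤ Lb') (B2 : Lb' ≤ l2 + l16 + lr)
    (hLa : La ≤ l2 + lr) (hLb : Lb ≤ l2 + lr)
    (da0 : -La / 2 ≤ a0) (db0 : -Lb / 2 ≤ b0)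
    (ua' : a0' ≤ -La' / 2 + l6 / 2) (ub' : b0' ≤ -Lb' / 2 + l6 / 2)
    (daa : aa ≤ -La / 2 + La' / 2 + l6 / 2) (dbb : bb ≤ -Lb / 2 + Lb' / 2 + l6 / 2)
    (hab : ab ≤ l8)
    (G1 : (a0' + b0' - ab') / 2 ≥ min ((a0' + a0 - aa) / 2) ((b0' + a0 - ba) / 2) - δ)
    (G2 : (b0' + a0 - ba) / 2 ≥ min ((b0' + b0 - bb) / 2) ((a0 + b0 - ab) / 2) - δ) :
    ab' ≤ l2 + 3 / 2 * l6 + 4 * δ := by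
  rcases min_le_iff.mp (sub_le_iff_le_add.mp G1) with h | h
  · clear G1 G2; linarith
  · rcases min_le_iff.mp (sub_le_iff_le_add.mp G2) with h' | h'
    · clear G1 G2; linarith
    · clear G1 G2; linarith

set_option maxHeartbeats 1000000 in
theorem contr {C : Set (Euc 2)} (hG : Good C) {δ : ℝ} (hδ : 0 ≤ δ) (hyp : IsDeltaHyp C δ)
    {p u : Euc 2} (h1 : p + u ∈ C) (h2 : p - u ∈ C)
    {l : ℝ} (hl : l = 1 - 16 * EE δ * (1 - gauge C p)) (hl0 : 0 < l) :
    l • p + (l * (1 + 1 / EE δ)) • u ∈ C ∧ l • p - (l * (1 + 1 / EE δ)) • u ∈ C := by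
  have hE := EE_ge hδ
  have hp : p ∈ C := by
    have := hG.cvx h1 h2 (a := 1/2) (b := 1/2) (by norm_num) (by norm_num) (by norm_num)
    have e : (1/2:ℝ) • (p + u) + (1/2:ℝ) • (p - u) = p := by module
    rwa [e] at this
  have gp := hG.gmem.mpr hp
  have hl1 : l < 1 := by nlinarith
  by_cases hu : u = 0
  · subst hu; simp only [smul_zero, add_zero, sub_zero, and_self]; exact hG.star hp hl0.le hl1.le
  set E := EE δ with hEdef
  have hE0 : 0 < E := by linarith
  obtain ⟨e, he⟩ : ∃ e, e = 1 / (4 * E) := ⟨_, rfl⟩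
  have he0 : 0 < e := by rw [he]; positivity
  have heE : e * E = 1 / 4 := by rw [he]; field_simp
  have he1 : e < 1 / 2 := by nlinarith
  set a := p + (1 - e) • u with ha
  set b := p - (1 - e) • u with hb
  have haC : a ∈ C := hG.seg hp h1 (by linarith) (by linarith)
  have hbC : b ∈ C := by
    have := hG.seg hp (w := -u) (by rwa [← sub_eq_add_neg]) (x := 1 - e) (by linarith) (by linarith)
    rwa [smul_neg, ← sub_eq_add_neg] at this
  have hab : a ≠ b := by
    intro h
    have : (2 * (1 - e)) • u = 0 := by
      have h' : a - b = 0 := sub_eq_zero.mpr h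
      rw [← h', ha, hb]; module
    rcases smul_eq_zero.mp this with h' | h'
    · linarith
    · exact hu h'
  -- upper bound of d(a,b)
  have hs : 0 < e / (2 * (1 - e)) := div_pos he0 (by linarith)
  have hne : (1 - e) ≠ 0 := by linarith
  have hdab : hDist C a b ≤ Real.log (8 * E) := by
    have := hd_ub hG.opn hG.bdd hab hs hs
      (by
        have : a - (e / (2 * (1 - e))) • (b - a) = p + u := by
          have h' : (1 - e) * (1 + 2 * (e / (2 * (1 - e)))) = 1 := by field_simp; ring
          have h'' : p + u = p + ((1 - e) * (1 + 2 * (e / (2 * (1 - e))))) • u := by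
            rw [h', one_smul]
          rw [h'', ha, hb]
          module
        rwa [this])
      (by
        have : b + (e / (2 * (1 - e))) • (b - a) = p - u := by
          have h' : (1 - e) * (1 + 2 * (e / (2 * (1 - e)))) = 1 := by field_simp; ring
          have h'' : p - u = p - ((1 - e) * (1 + 2 * (e / (2 * (1 - e))))) • u := by
            rw [h', one_smul]
          rw [h'', ha, hb]
          module
        rwa [this])
    have h3 : (1 + e / (2 * (1 - e))) / (e / (2 * (1 - e))) ≤ 8 * E := by
      rw [div_le_iff₀ hs]
      have h5 : 8 * E * (e / (2 * (1 - e))) = 1 / (1 - e) := by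
        rw [mul_div_assoc', show 8 * E * e = 8 * (e * E) by ring, heE]; field_simp; norm_num
      rw [h5]
      have h4 : 1 + e / (2 * (1 - e)) = (2 - e) / (2 * (1 - e)) := by field_simp; ring
      rw [h4, div_le_div_iff₀ (by linarith) (by linarith)]
      nlinarith
    have h6 := Real.log_le_log (by positivity) h3
    rw [Real.log_mul (by positivity) (by positivity)] at this
    linarith
  have hmid : gauge C p ≤ gauge C a / 2 + gauge C b / 2 := by
    have h := hG.gadd ((1/2:ℝ) • a) ((1/2:ℝ) • b)
    rw [Good.gsmul (by norm_num), Good.gsmul (by norm_num)] at h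
    have e1 : (1/2:ℝ) • a + (1/2:ℝ) • b = p := by rw [ha, hb]; module
    rw [e1] at h; linarith
  have ga := hG.gmem.mpr haC
  have gb := hG.gmem.mpr hbC
  have ga0 : 0 ≤ gauge C a := gauge_nonneg a
  have gb0 : 0 ≤ gauge C b := gauge_nonneg b
  set ρ := 1 - gauge C p with hρ
  have hρ0 : 0 < ρ := by linarith
  have ra : 1 - gauge C a ≤ 2 * ρ := by linarith
  have rb : 1 - gauge C b ≤ 2 * ρ := by linarith
  have ha'C : l • a ∈ C := hG.star haC hl0.le hl1.le
  have hb'C : l • b ∈ C := hG.star hbC hl0.le hl1.le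
  have ga' : gauge C (l • a) = l * gauge C a := Good.gsmul hl0.le a
  have gb' : gauge C (l • b) = l * gauge C b := Good.gsmul hl0.le b
  -- bounds on the depth of a', b'
  have bnd : ∀ x : ℝ, 0 ≤ x → x < 1 → 1 - x ≤ 2 * ρ →
      Real.log (16 * E) + Real.log ρ ≤ Real.log (1 - l * x) ∧
      Real.log (1 - l * x) ≤ Real.log 2 + Real.log (16 * E) + Real.log ρ := by
    intro x hx0 hx1 hx2
    have y1 : 16 * E * ρ ≤ 1 - l * x := by nlinarith
    have y2 : 1 - l * x ≤ 2 * (16 * E) * ρ := by nlinarith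
    constructor
    · rw [← Real.log_mul (by positivity) (by positivity)]
      exact Real.log_le_log (by positivity) y1
    · rw [← Real.log_mul (by positivity) (by positivity),
        ← Real.log_mul (by positivity) (by positivity)]
      exact Real.log_le_log (lt_of_lt_of_le (by positivity) y1) y2
  obtain ⟨A1, A2⟩ := bnd _ ga0 ga ra
  obtain ⟨B1, B2⟩ := bnd _ gb0 gb rb
  have La : Real.log (1 - gauge C a) ≤ Real.log 2 + Real.log ρ := by
    rw [← Real.log_mul (by positivity) (by positivity)]
    exact Real.log_le_log (by linarith) ra
  have Lb : Real.log (1 - gauge C b) ≤ Real.log 2 + Real.log ρ := by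
    rw [← Real.log_mul (by positivity) (by positivity)]
    exact Real.log_le_log (by linarith) rb
  have l16 : Real.log (16 * E) = Real.log 2 + Real.log (8 * E) := by
    rw [← Real.log_mul (by positivity) (by positivity)]; congr 1; ring
  have G1 := hyp (l • a) ha'C (l • b) hb'C a haC 0 hG.zero
  have G2 := hyp (l • b) hb'C a haC b hbC 0 hG.zero
  have da0 := hG.hd0_lb haC
  have db0 := hG.hd0_lb hbC
  have ua' := hG.hd0_ub ha'C
  have ub' := hG.hd0_ub hb'C
  have daa := hG.hdl_ub haC hl0 hl1
  have dbb := hG.hdl_ub hbC hl0 hl1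
  rw [ga'] at ua' daa
  rw [gb'] at ub' dbb
  unfold gromovProd at G1 G2
  have hfin : hDist C (l • a) (l • b) ≤ Real.log 2 + 3 / 2 * Real.log 6 + 4 * δ :=
    contr_arith (by positivity) (by positivity) hδ l16 A1 A2 B1 B2 La Lb da0 db0 ua' ub'
      daa dbb hdab G1 G2
  have hexp : Real.exp (2 * (Real.log 2 + 3 / 2 * Real.log 6 + 4 * δ)) = E := by
    have : 2 * (Real.log 2 + 3 / 2 * Real.log 6 + 4 * δ)
      = Real.log (2 ^ 2 * 6 ^ 3) + 8 * δ := by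
      rw [Real.log_mul (by norm_num) (by norm_num), Real.log_pow, Real.log_pow]; push_cast; ring
    rw [this, Real.exp_add, Real.exp_log (by norm_num), hEdef, EE]; norm_num
  have hmem := hd_lb hG.cvx hG.opn hG.bdd ha'C hb'C (s := 1 / E) (by positivity) hfin (by
    rw [hexp, lt_div_iff₀ (by positivity)]
    have : E * (1 / E) = 1 := by field_simp
    rw [this]
    have : 0 < 1 / E := by positivity
    linarith)
  have hlp : l • p ∈ C := hG.star hp hl0.le hl1.le
  set m := (1 - e) * (1 + 2 * (1 / E)) with hm
  have hmm : 1 + 1 / E ≤ m := by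
    have hi : e = (1 / E) / 4 := by rw [he]; field_simp
    have hi2 : 1 / E ≤ 1 / 864 := one_div_le_one_div_of_le (by norm_num) hE
    have hi3 : 0 < 1 / E := by positivity
    rw [hm, hi]; nlinarith
  have hi3 : 0 < 1 / E := by positivity
  have hm0 : 0 < m := by linarith
  have q1 : l • p + (l * m) • u ∈ C := by
    have := hmem.1
    have e1 : l • a - (1 / E) • (l • b - l • a) = l • p + (l * m) • u := by
      rw [ha, hb, hm]; module
    rwa [e1] at this
  have q2 : l • p + (-(l * m) • u) ∈ C := by
    have := hmem.2
    have e1 : l • b + (1 / E) • (l • b - l • a) = l • p + (-(l * m) • u) := by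
      rw [ha, hb, hm]; module
    rwa [e1] at this
  have hx1 : (1 + 1 / E) / m ≤ 1 := by rwa [div_le_one hm0]
  have hx0 : 0 ≤ (1 + 1 / E) / m := by positivity
  have r1 := hG.seg hlp q1 hx0 hx1
  have r2 := hG.seg hlp q2 hx0 hx1
  have hx : (1 + 1 / E) / m * (l * m) = l * (1 + 1 / E) := by field_simp
  constructor
  · rw [smul_smul, hx] at r1; exact r1
  · rw [smul_smul, mul_neg, hx, neg_smul, ← sub_eq_add_neg] at r2; exact r2

/-- planar determinant -/
def dt (a b : Euc 2) : ℝ := a 0 * b 1 - a 1 * b 0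

theorem dt_smul_left (x : ℝ) (a b : Euc 2) : dt (x • a) b = x * dt a b := by
  simp [dt]; ring
theorem dt_smul_right (x : ℝ) (a b : Euc 2) : dt a (x • b) = x * dt a b := by
  simp [dt]; ring
theorem dt_add_right (a b c : Euc 2) : dt a (b + c) = dt a b + dt a c := by
  simp [dt]; ring
theorem dt_sub_right (a b c : Euc 2) : dt a (b - c) = dt a b - dt a c := by
  simp [dt]; ring
theorem dt_add_left (a b c : Euc 2) : dt (a + b) c = dt a c + dt b c := by
  simp [dt]; ring
theorem dt_self (a : Euc 2) : dt a a = 0 := by simp [dt]; ring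
theorem dt_swap (a b : Euc 2) : dt a b = - dt b a := by simp [dt]; ring
theorem dt_cont_left (b : Euc 2) : Continuous fun a => dt a b := by unfold dt; fun_prop
theorem dt_cont (f g : Euc 2 → Euc 2) (hf : Continuous f) (hg : Continuous g) :
    Continuous fun a => dt (f a) (g a) := by unfold dt; fun_prop

theorem cramer2 (p q z : Euc 2) : dt p q • z = dt z q • p + dt p z • q := by
  ext i; fin_cases i <;> simp [dt] <;> ring

/-- linear map with given columns -/
noncomputable def Tm (a b : Euc 2) : Euc 2 →ₗ[ℝ] Euc 2 where
  toFun x := x 0 • a + x 1 • b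
  map_add' x y := by simp only [PiLp.add_apply]; module
  map_smul' r x := by simp only [PiLp.smul_apply, smul_eq_mul, RingHom.id_apply]; module

theorem Tm_apply (a b x : Euc 2) : Tm a b x = x 0 • a + x 1 • b := rfl

theorem Tm_det (a b : Euc 2) : LinearMap.det (Tm a b) = dt a b := by
  rw [← LinearMap.det_toMatrix (EuclideanSpace.basisFun (Fin 2) ℝ).toBasis, Matrix.det_fin_two]
  simp [LinearMap.toMatrix_apply, Tm_apply, dt]
  ring

theorem om_pos : 0 < omegaVol 2 :=
  ENNReal.toReal_pos (Metric.measure_ball_pos volume _ one_pos).ne' measure_ball_lt_top.ne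

theorem vol_Tball (a b : Euc 2) {r : ℝ} (hr : 0 ≤ r) :
    volume (Tm a b '' Metric.ball 0 r) = ENNReal.ofReal (|dt a b| * r ^ 2 * omegaVol 2) := by
  rw [Measure.addHaar_image_linearMap, Tm_det, Measure.addHaar_ball _ _ hr]
  have : volume (Metric.ball (0 : Euc 2) 1) = ENNReal.ofReal (omegaVol 2) := by
    rw [omegaVol, ENNReal.ofReal_toReal measure_ball_lt_top.ne]
  rw [this, finrank_euclideanSpace_fin, ← ENNReal.ofReal_mul (by positivity),
    ← ENNReal.ofReal_mul (by positivity), mul_assoc]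

theorem ball_coord {x : Euc 2} {r : ℝ} (hx : x ∈ Metric.ball (0 : Euc 2) r) :
    |x 0| < r ∧ |x 1| < r := by
  rw [mem_ball_zero_iff] at hx
  constructor <;> refine lt_of_le_of_lt ?_ hx
  · exact PiLp.norm_apply_le x 0
  · exact PiLp.norm_apply_le x 1

theorem vol_para {p q : Euc 2} (hA : dt p q ≠ 0) {k : ℝ} (hk : 0 < k) {S : Set (Euc 2)}
    (hS : ∀ z ∈ S, |dt z q| ≤ k * |dt p q| ∧ |dt z p| ≤ k * |dt p q|) :
    volume S ≤ ENNReal.ofReal (|dt p q| * (2 * k) ^ 2 * omegaVol 2) := by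
  rw [← vol_Tball p q (by positivity)]
  refine measure_mono fun z hz => ?_
  obtain ⟨h1, h2⟩ := hS z hz
  have hA' : 0 < |dt p q| := abs_pos.mpr hA
  refine ⟨!₂[dt z q / dt p q, dt p z / dt p q], ?_, ?_⟩
  · rw [mem_ball_zero_iff, EuclideanSpace.norm_eq, Real.sqrt_lt' (by positivity)]
    simp only [Fin.sum_univ_two, Real.norm_eq_abs, sq_abs]
    have e1 : |dt z q / dt p q| ≤ k := by rw [abs_div, div_le_iff₀ hA']; exact h1
    have e2 : |dt p z / dt p q| ≤ k := by
      rw [abs_div, div_le_iff₀ hA', dt_swap p z, abs_neg]; exact h2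
    have e3 := sq_le_sq' (by linarith [abs_le.mp e1 |>.1]) (abs_le.mp e1).2
    have e4 := sq_le_sq' (by linarith [abs_le.mp e2 |>.1]) (abs_le.mp e2).2
    simp
    nlinarith
  · rw [Tm_apply]
    have := cramer2 p q z
    have h3 : z = (dt p q)⁻¹ • (dt p q • z) := by rw [smul_smul, inv_mul_cancel₀ hA, one_smul]
    conv_rhs => rw [h3, this]
    simp [smul_smul, smul_add, div_eq_inv_mul]

theorem det_le_vol {C : Set (Euc 2)} (hG : Good C) {x y : Euc 2} (hx : x ∈ C) (hy : y ∈ C) :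
    |dt x y| * omegaVol 2 / 16 ≤ (volume C).toReal := by
  have hfin : volume C ≠ ⊤ := hG.bdd.measure_lt_top.ne
  have h1 : volume (Tm x y '' Metric.ball 0 (1/4)) ≤ volume C := by
    refine measure_mono ?_
    rintro _ ⟨t, ht, rfl⟩
    obtain ⟨h0, h1⟩ := ball_coord ht
    rw [Tm_apply, ← hG.gmem]
    have key : ∀ (s : ℝ) (w : Euc 2), |s| < 1/4 → w ∈ C → gauge C (s • w) < 1/2 := by
      intro s w hs hw
      have gw := hG.gmem.mpr hw
      have gw0 : 0 ≤ gauge C w := gauge_nonneg w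
      rcases le_total 0 s with h | h
      · rw [Good.gsmul h]; rw [abs_of_nonneg h] at hs; nlinarith
      · rw [abs_of_nonpos h] at hs
        have : s • w = (-s) • (-w) := by simp
        rw [this, Good.gsmul (by linarith)]
        have := hG.gneg w
        have := mul_le_mul_of_nonneg_left this (neg_nonneg.mpr h)
        nlinarith
    have := hG.gadd (t 0 • x) (t 1 • y)
    have := key _ _ h0 hx
    have := key _ _ h1 hy
    linarith
  rw [vol_Tball _ _ (by norm_num)] at h1
  have := (ENNReal.ofReal_le_iff_le_toReal hfin).mp h1
  linarith

/-- there is a large transverse symmetric vector at `z` -/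
def HP (C : Set (Euc 2)) (z : Euc 2) (c : ℝ) : Prop := ∃ v, z + v ∈ C ∧ z - v ∈ C ∧ c < dt z v

theorem HP_open {C : Set (Euc 2)} (ho : IsOpen C) (c : ℝ) : IsOpen {z | HP C z c} := by
  have : {z | HP C z c} = ⋃ v : Euc 2, ((fun z => z + v) ⁻¹' C ∩ (fun z => z - v) ⁻¹' C ∩
      (fun z => dt z v) ⁻¹' Ioi c) := by
    ext z; simp [HP, and_assoc]
  rw [this]
  refine isOpen_iUnion fun v => ((ho.preimage (by fun_prop)).inter (ho.preimage (by fun_prop))).inter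
    (isOpen_Ioi.preimage (dt_cont_left v))

theorem HP_mem {C : Set (Euc 2)} (hc : Convex ℝ C) {z : Euc 2} {c : ℝ} (h : HP C z c) : z ∈ C := by
  obtain ⟨v, h1, h2, -⟩ := h
  have := hc h1 h2 (a := 1/2) (b := 1/2) (by norm_num) (by norm_num) (by norm_num)
  have e : (1/2:ℝ) • (z + v) + (1/2:ℝ) • (z - v) = z := by module
  rwa [e] at this

theorem HP_scale {C : Set (Euc 2)} (hG : Good C) {z : Euc 2} {c x : ℝ} (h : HP C z c)
    (h0 : 0 < x) (h1 : x ≤ 1) : HP C (x • z) (x ^ 2 * c) := by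
  obtain ⟨v, a1, a2, a3⟩ := h
  refine ⟨x • v, ?_, ?_, ?_⟩
  · rw [← smul_add]; exact hG.star a1 h0.le h1
  · rw [← smul_sub]; exact hG.star a2 h0.le h1
  · rw [dt_smul_left, dt_smul_right]
    have : 0 < x ^ 2 := by positivity
    nlinarith

theorem HP_contr {C : Set (Euc 2)} (hG : Good C) {δ : ℝ} (hδ : 0 ≤ δ) (hyp : IsDeltaHyp C δ)
    {z : Euc 2} {c : ℝ} (h : HP C z c) {l : ℝ}
    (hl : l = 1 - 16 * EE δ * (1 - gauge C z)) (hl0 : 0 < l) :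
    HP C (l • z) (l ^ 2 * ((1 + 1 / EE δ) * c)) := by
  obtain ⟨v, a1, a2, a3⟩ := h
  obtain ⟨b1, b2⟩ := contr hG hδ hyp a1 a2 hl hl0
  refine ⟨_, b1, b2, ?_⟩
  have hE := EE_ge hδ
  have : 0 < l ^ 2 * (1 + 1 / EE δ) := by positivity
  rw [dt_smul_left, dt_smul_right]
  have := mul_lt_mul_of_pos_left a3 this
  nlinarith

theorem HP_iter {C : Set (Euc 2)} (hG : Good C) {δ : ℝ} (hδ : 0 ≤ δ) (hyp : IsDeltaHyp C δ)
    (j : ℕ) : ∀ {z : Euc 2} {c x : ℝ}, HP C z c → 0 < x → x ≤ 1 →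
    (1 + 16 * EE δ) ^ j * (1 - gauge C z) ≤ 1 - gauge C (x • z) →
    HP C (x • z) (x ^ 2 * ((1 + 1 / EE δ) ^ j * c)) := by
  have hE := EE_ge hδ
  induction j with
  | zero => intro z c x h h0 h1 _; simpa using HP_scale hG h h0 h1
  | succ j ih =>
    intro z c x h h0 h1 hz
    have gz := hG.gmem.mpr (HP_mem hG.cvx h)
    have gz0 : 0 ≤ gauge C z := gauge_nonneg z
    have gx0 : 0 ≤ gauge C (x • z) := gauge_nonneg _
    have hp1 : 1 ≤ (1 + 16 * EE δ) ^ j := one_le_pow₀ (by linarith)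
    rw [pow_succ] at hz
    have hz2 : (1 + 16 * EE δ) * (1 - gauge C z) ≤ 1 - gauge C (x • z) := by
      refine le_trans ?_ hz
      rw [mul_assoc]
      have : 0 ≤ (1 + 16 * EE δ) * (1 - gauge C z) := by
        apply mul_nonneg <;> linarith
      nlinarith
    obtain ⟨l, hl⟩ : ∃ l, l = 1 - 16 * EE δ * (1 - gauge C z) := ⟨_, rfl⟩
    have hl0 : 0 < l := by nlinarith
    have hl1 : l < 1 := by nlinarith
    have H := HP_contr hG hδ hyp h hl hl0
    have gl : gauge C (l • z) = l * gauge C z := Good.gsmul hl0.le z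
    have gx : gauge C (x • z) = x * gauge C z := Good.gsmul h0.le z
    have hgl : 1 - gauge C (l • z) ≤ (1 + 16 * EE δ) * (1 - gauge C z) := by
      rw [gl]; nlinarith
    have hxl : x ≤ l := by
      by_contra hcon
      push Not at hcon
      have : l * gauge C z < x * gauge C z := by
        refine mul_lt_mul_of_pos_right hcon (lt_of_le_of_ne gz0 ?_)
        intro h'
        rw [gx, ← h'] at hz2
        linarith
      linarith
    have e : x • z = (x / l) • (l • z) := by
      rw [smul_smul, div_mul_cancel₀ _ hl0.ne']
    have := ih (x := x / l) H (by positivity) (by rwa [div_le_one hl0]) (by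
      rw [← e]
      refine le_trans ?_ hz
      rw [mul_assoc]
      gcongr)
    rw [← e] at this
    convert this using 1
    rw [pow_succ]
    generalize (1 + 1 / EE δ) = κ
    field_simp
    ring

/-- density of the Hilbert measure -/
noncomputable def dens (C : Set (Euc 2)) (z : Euc 2) : ℝ≥0∞ :=
  ENNReal.ofReal (omegaVol 2 / (volume (tangentBall C z 1)).toReal)

theorem tb_fin {C : Set (Euc 2)} (ho : IsOpen C) (hb : Bornology.IsBounded C) {z : Euc 2}
    (hz : z ∈ C) : volume (tangentBall C z 1) ≠ ⊤ := by
  obtain ⟨R, hR⟩ := hb.exists_norm_le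
  exact ((measure_mono (tb_bdd ho hR hz)).trans_lt measure_ball_lt_top).ne

theorem dens_le {C : Set (Euc 2)} (hG : Good C) {z : Euc 2} (hz : z ∈ C) {m : ℝ} (hm : 0 < m)
    {S : Set (Euc 2)} (hS : ENNReal.ofReal m ≤ volume S) (h : ∀ v ∈ S, z + v ∈ C ∧ z - v ∈ C) :
    dens C z ≤ ENNReal.ofReal (omegaVol 2 / m) := by
  have h1 : ENNReal.ofReal m ≤ volume (tangentBall C z 1) :=
    hS.trans (measure_mono fun v hv => fNorm_lt_one hG.opn hG.bdd (h v hv).1 (h v hv).2)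
  have h2 := (ENNReal.ofReal_le_iff_le_toReal (tb_fin hG.opn hG.bdd hz)).mp h1
  have := om_pos
  unfold dens
  gcongr

theorem seg_abs {C : Set (Euc 2)} (hG : Good C) {z v : Euc 2} (h1 : z + v ∈ C) (h2 : z - v ∈ C)
    (hz : z ∈ C) {t : ℝ} (ht : |t| ≤ 1) : z + t • v ∈ C := by
  rcases le_total 0 t with h | h
  · rw [abs_of_nonneg h] at ht; exact hG.seg hz h1 h ht
  · rw [abs_of_nonpos h] at ht
    have := hG.seg hz (w := -v) (by rwa [← sub_eq_add_neg]) (neg_nonneg.mpr h) ht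
    simpa using this

theorem dens1 {C : Set (Euc 2)} (hG : Good C) {z : Euc 2} {c : ℝ} (hc : 0 < c) (h : HP C z c) :
    dens C z ≤ ENNReal.ofReal (8 * gauge C z / ((1 - gauge C z) * c)) := by
  have hz := HP_mem hG.cvx h
  obtain ⟨v, h1, h2, h3⟩ := h
  have hz0 : z ≠ 0 := by
    rintro rfl
    have : dt 0 v = 0 := by simp [dt]
    linarith
  have g1 := hG.gmem.mpr hz
  have g0 := hG.gpos hz0
  set g := gauge C z with hg
  have hg1 : 0 < 1 - g := by linarith
  obtain ⟨s, hs⟩ : ∃ s, s = (1 - g) / (2 * g) := ⟨_, rfl⟩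
  have hs0 : 0 < s := by rw [hs]; positivity
  have k1 : z + s • z ∈ C := by
    have : z + s • z = (1 + s) • z := by module
    rw [this, ← hG.gmem, Good.gsmul (by positivity), ← hg, hs]
    have : (1 + (1 - g) / (2 * g)) * g = (1 + g) / 2 := by field_simp; ring
    linarith
  have k2 : z - s • z ∈ C := by
    have e : z - s • z = (1 - s) • z := by module
    rcases le_total s 1 with h | h
    · rw [e]; exact hG.star hz (by linarith) (by linarith)
    · have e2 : z - s • z = (s - 1) • (-z) := by module
      rw [e2, ← hG.gmem, Good.gsmul (by linarith)]
      have h4 := hG.gneg z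
      have h5 := mul_le_mul_of_nonneg_left h4 (sub_nonneg.mpr h)
      refine h5.trans_lt ?_
      rw [← hg, hs]
      have : ((1 - g) / (2 * g) - 1) * (2 * g) = 1 - 3 * g := by field_simp; ring
      linarith
  have hd : |dt (s • z) v| = s * dt z v := by
    rw [dt_smul_left, abs_of_pos]; exact mul_pos hs0 (by linarith)
  have := dens_le hG hz (m := s * c * (1/4) * omegaVol 2) (by have := om_pos; positivity)
    (S := Tm (s • z) v '' Metric.ball 0 (1/2)) (by
      rw [vol_Tball _ _ (by norm_num), hd]
      have := om_pos
      apply ENNReal.ofReal_le_ofReal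
      norm_num
      gcongr)
    (by
      rintro _ ⟨t, ht, rfl⟩
      obtain ⟨b0, b1⟩ := ball_coord ht
      have key : ∀ x y : ℝ, |x| < 1/2 → |y| < 1/2 → z + (x • s • z + y • v) ∈ C := by
        intro x y hx hy
        have c1 := seg_abs hG k1 k2 hz (t := 2 * x) (by rw [abs_mul, abs_two]; linarith)
        have c2 := seg_abs hG h1 h2 hz (t := 2 * y) (by rw [abs_mul, abs_two]; linarith)
        have := hG.cvx c1 c2 (a := 1/2) (b := 1/2) (by norm_num) (by norm_num) (by norm_num)
        convert this using 1
        module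
      refine ⟨key _ _ b0 b1, ?_⟩
      have := key (-t 0) (-t 1) (by rwa [abs_neg]) (by rwa [abs_neg])
      rw [Tm_apply]
      convert this using 1
      module)
  convert this using 2
  have := om_pos
  rw [hs]; field_simp; norm_num

open scoped Pointwise in
theorem dens2 {C : Set (Euc 2)} (hG : Good C) {z : Euc 2} (hz : gauge C z ≤ 1 / 2) :
    dens C z ≤ ENNReal.ofReal (16 * omegaVol 2 / (volume C).toReal) := by
  have hzC : z ∈ C := hG.gmem.mp (by linarith)
  have hpos : 0 < (volume C).toReal := ENNReal.toReal_pos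
    (hG.opn.measure_pos volume ⟨0, hG.zero⟩).ne' hG.bdd.measure_lt_top.ne
  have := dens_le hG hzC (m := (volume C).toReal / 16) (by positivity) (S := (1/4 : ℝ) • C) (by
      rw [Measure.addHaar_smul, finrank_euclideanSpace_fin,
        ← ENNReal.ofReal_toReal hG.bdd.measure_lt_top.ne, ← ENNReal.ofReal_mul (by positivity)]
      apply ENNReal.ofReal_le_ofReal
      rw [ENNReal.toReal_ofReal (by positivity), abs_of_pos (by positivity)]; linarith)
    (by
      rintro _ ⟨v, hv, rfl⟩
      have g1 := hG.gmem.mpr hv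
      have e1 : gauge C ((1/4 : ℝ) • v) = 1/4 * gauge C v := Good.gsmul (by norm_num) v
      have e2 := hG.gneg ((1/4 : ℝ) • v)
      constructor
      · rw [← hG.gmem]
        have := hG.gadd z ((1/4 : ℝ) • v)
        simp only
        linarith
      · rw [← hG.gmem]
        have := hG.gadd z (-((1/4 : ℝ) • v))
        simp only [sub_eq_add_neg]
        linarith)
  convert this using 2
  field_simp

theorem hm_le {C : Set (Euc 2)} {S T : Set (Euc 2)} (hST : S ⊆ T) (hT : MeasurableSet T)
    {B : ℝ≥0∞} (hB : ∀ z ∈ T, dens C z ≤ B) : hMeasure C S ≤ B * volume T := by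
  refine (measure_mono hST).trans ?_
  unfold hMeasure
  rw [withDensity_apply _ hT]
  calc ∫⁻ z in T, dens C z ∂(volume.restrict C)
      ≤ ∫⁻ _ in T, B ∂(volume.restrict C) := setLIntegral_mono' hT hB
    _ = B * (volume.restrict C) T := by rw [setLIntegral_const]
    _ ≤ B * volume T := by gcongr; exact Measure.restrict_le_self

theorem hm_null {C S : Set (Euc 2)} (h : volume S = 0) : hMeasure C S = 0 := by
  unfold hMeasure
  exact withDensity_absolutelyContinuous _ _ (Measure.restrict_le_self.absolutelyContinuous h)

/-- the cone with vertex the origin over `V` -/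
def coneS (V : Set (Euc 2)) : Set (Euc 2) := {z | ∃ q ∈ V, ∃ x : ℝ, 0 ≤ x ∧ x ≤ 1 ∧ z = x • q}

noncomputable def dtL (p : Euc 2) : Euc 2 →ₗ[ℝ] ℝ where
  toFun z := dt p z
  map_add' := dt_add_right p
  map_smul' x z := by simp [dt_smul_right]

theorem cone_null {C V : Set (Euc 2)} (h : ∀ p ∈ V, ∀ q ∈ V, dt p q = 0) :
    hMeasure C (coneS V) = 0 := by
  apply hm_null
  by_cases hV : ∃ p ∈ V, p ≠ 0
  · obtain ⟨p, hp, hp0⟩ := hV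
    have h1 : coneS V ⊆ (LinearMap.ker (dtL p) : Set (Euc 2)) := by
      rintro _ ⟨q, hq, x, -, -, rfl⟩
      simp only [SetLike.mem_coe, LinearMap.mem_ker]
      change dt p (x • q) = 0
      rw [dt_smul_right, h p hp q hq, mul_zero]
    refine measure_mono_null h1 (Measure.addHaar_submodule _ _ ?_)
    intro htop
    apply hp0
    have : dt p !₂[-p 1, p 0] = 0 := by
      have : (!₂[-p 1, p 0] : Euc 2) ∈ LinearMap.ker (dtL p) := by rw [htop]; trivial
      exact this
    simp [dt] at this
    have a0 : p 0 = 0 := by nlinarith [sq_nonneg (p 0), sq_nonneg (p 1)]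
    have a1 : p 1 = 0 := by nlinarith [sq_nonneg (p 0), sq_nonneg (p 1)]
    ext i; fin_cases i <;> simp [a0, a1]
  · push Not at hV
    have h1 : coneS V ⊆ {0} := by
      rintro _ ⟨q, hq, x, -, -, rfl⟩
      simp [hV q hq]
    exact measure_mono_null h1 (measure_singleton _)

theorem small_dist {C : Set (Euc 2)} (hG : Good C) {p q : Euc 2} (hp : p ∈ C) (hq : q ∈ C)
    {Δ : ℝ} (h0 : 0 < Δ) (h1 : Δ ≤ 1 / 8) (hD : hDist C p q ≤ Δ) :
    (1 - gauge C p) / 2 ≤ 1 - gauge C q ∧ ∀ c, c < |dt p q| / (4 * Δ) → HP C p c := by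
  obtain ⟨s, hs⟩ : ∃ s, s = 1 / (4 * Δ) := ⟨_, rfl⟩
  have hs0 : 0 < s := by rw [hs]; positivity
  have hs2 : 2 ≤ s := by rw [hs, le_div_iff₀ (by positivity)]; linarith
  have hexp : Real.exp (2 * Δ) < (1 + s) / s := by
    have := Real.abs_exp_sub_one_sub_id_le (x := 2 * Δ) (by rw [abs_of_pos] <;> linarith)
    have := (abs_le.mp this).2
    have e : (1 + s) / s = 1 + 4 * Δ := by rw [hs]; field_simp; ring
    rw [e]; nlinarith
  obtain ⟨a1, a2⟩ := hd_lb hG.cvx hG.opn hG.bdd hp hq hs0 hD hexp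
  have a3 : p + (1 + s) • (q - p) ∈ C := by
    convert a2 using 1; module
  have a4 : p + s • (q - p) ∈ C := by
    have := hG.seg hp a3 (x := s / (1 + s)) (by positivity) (by rw [div_le_one] <;> linarith)
    rwa [smul_smul, div_mul_cancel₀ _ (by positivity)] at this
  have gp := hG.gmem.mpr hp
  constructor
  · have e : q = (s / (1 + s)) • p + (1 / (1 + s)) • (p + (1 + s) • (q - p)) := by
      have : s / (1 + s) = 1 - 1 / (1 + s) := by field_simp; ring
      rw [this, smul_add, smul_smul, div_mul_cancel₀ _ (by positivity)]; module
    have g1 := hG.gadd ((s / (1 + s)) • p) ((1 / (1 + s)) • (p + (1 + s) • (q - p)))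
    rw [← e, Good.gsmul (by positivity), Good.gsmul (by positivity)] at g1
    have g2 := hG.gmem.mpr a3
    have g3 : 1 / (1 + s) * gauge C (p + (1 + s) • (q - p)) ≤ 1 / (1 + s) * 1 := by
      gcongr
    have e2 : 1 / (1 + s) = 1 - s / (1 + s) := by field_simp; ring
    have e3 : 1 / 2 ≤ s / (1 + s) := by rw [div_le_div_iff₀] <;> linarith
    nlinarith
  · intro c hc
    have e : |dt p q| / (4 * Δ) = s * |dt p q| := by rw [hs]; field_simp
    rw [e] at hc
    rcases le_total 0 (dt p q) with h | h
    · rw [abs_of_nonneg h] at hc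
      refine ⟨s • (q - p), a4, a1, ?_⟩
      rw [dt_smul_right, dt_sub_right, dt_self, sub_zero]; exact hc
    · rw [abs_of_nonpos h] at hc
      refine ⟨-(s • (q - p)), ?_, ?_, ?_⟩
      · rwa [← sub_eq_add_neg]
      · rwa [sub_neg_eq_add]
      · rw [← neg_smul, dt_smul_right, dt_sub_right, dt_self, sub_zero]; linarith

theorem near_sup {C V : Set (Euc 2)} (hG : Good C) (hV : V ⊆ C) (hne : V.Nonempty) :
    ∃ p ∈ V, ∃ q ∈ V, ∀ x ∈ V, ∀ y ∈ V, |dt x y| ≤ 2 * |dt p q| := by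
  let S : Set ℝ := {r | ∃ p ∈ V, ∃ q ∈ V, r = |dt p q|}
  have hb : BddAbove S := by
    refine ⟨(volume C).toReal * 16 / omegaVol 2, ?_⟩
    rintro _ ⟨p, hp, q, hq, rfl⟩
    have := det_le_vol hG (hV hp) (hV hq)
    rw [le_div_iff₀ om_pos]; linarith
  obtain ⟨v, hv⟩ := hne
  have hSne : S.Nonempty := ⟨_, v, hv, v, hv, rfl⟩
  by_cases hs : sSup S ≤ 0
  · refine ⟨v, hv, v, hv, fun x hx y hy => ?_⟩
    have : |dt x y| ≤ sSup S := le_csSup hb ⟨x, hx, y, hy, rfl⟩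
    have := abs_nonneg (dt v v)
    linarith
  · push Not at hs
    obtain ⟨_, ⟨p, hp, q, hq, rfl⟩, h⟩ := exists_lt_of_lt_csSup hSne (half_lt_self hs)
    refine ⟨p, hp, q, hq, fun x hx y hy => ?_⟩
    have : |dt x y| ≤ sSup S := le_csSup hb ⟨x, hx, y, hy, rfl⟩
    linarith

/-- wedge around the pair `p, q` -/
def wedge (C : Set (Euc 2)) (p q : Euc 2) : Set (Euc 2) :=
  {z | |dt z q| ≤ 4 * |dt p q| * gauge C z ∧ |dt z p| ≤ 4 * |dt p q| * gauge C z}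

theorem wedge_closed {C : Set (Euc 2)} (hG : Good C) (p q : Euc 2) : IsClosed (wedge C p q) := by
  have := hG.gcont
  have h1 := dt_cont_left p
  have h2 := dt_cont_left q
  exact (isClosed_le h2.abs (by fun_prop)).inter (isClosed_le h1.abs (by fun_prop))

open scoped Pointwise in
theorem wedge_vol {C : Set (Euc 2)} (hG : Good C) {p q : Euc 2} (hA : dt p q ≠ 0)
    {s t : ℝ} (hs : 0 < s) (ht : t ≤ 1) (hst : s ≤ t) :
    volume (wedge C p q ∩ {z | s < gauge C z ∧ gauge C z ≤ t}) ≤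
      ENNReal.ofReal (2 * (t - s) * (64 * |dt p q| * omegaVol 2)) := by
  let R : ℝ → Set (Euc 2) := fun s => wedge C p q ∩ {z | gauge C z ≤ s}
  have hR : ∀ s, 0 < s → R s = s • R 1 := by
    intro s hs
    ext z
    rw [Set.mem_smul_set_iff_inv_smul_mem₀ hs.ne']
    simp only [R, wedge, mem_inter_iff, mem_setOf_eq, dt_smul_left,
      Good.gsmul (inv_nonneg.mpr hs.le), abs_mul, abs_of_pos (inv_pos.mpr hs)]
    have e : ∀ a b : ℝ, s⁻¹ * a ≤ 4 * b * (s⁻¹ * gauge C z) ↔ a ≤ 4 * b * gauge C z := by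
      intro a b
      have : 4 * b * (s⁻¹ * gauge C z) = s⁻¹ * (4 * b * gauge C z) := by ring
      rw [this, mul_le_mul_iff_right₀ (inv_pos.mpr hs)]
    rw [e, e, inv_mul_le_iff₀ hs, mul_one]
  have h1 : volume (R 1) ≤ ENNReal.ofReal (64 * |dt p q| * omegaVol 2) := by
    have := vol_para hA (k := 4) (by norm_num) (S := R 1) (by
      rintro z ⟨⟨a, b⟩, c⟩
      have c : gauge C z ≤ 1 := c
      have := abs_nonneg (dt p q)
      constructor <;> nlinarith)
    refine this.trans (ENNReal.ofReal_le_ofReal ?_)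
    have := om_pos
    have := abs_nonneg (dt p q)
    nlinarith
  have hfin : volume (R 1) ≠ ⊤ := (h1.trans_lt ENNReal.ofReal_lt_top).ne
  have hv : ∀ s, 0 < s → volume (R s) = ENNReal.ofReal (s ^ 2 * (volume (R 1)).toReal) := by
    intro s hs
    rw [hR s hs, Measure.addHaar_smul, finrank_euclideanSpace_fin, abs_of_pos (by positivity),
      ENNReal.ofReal_mul (by positivity), ENNReal.ofReal_toReal hfin]
  have hm : MeasurableSet (R s) :=
    (wedge_closed hG p q).measurableSet.inter (isClosed_le hG.gcont continuous_const).measurableSet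
  have hsub : R s ⊆ R t := fun z hz => ⟨hz.1, le_trans hz.2 hst⟩
  have e : wedge C p q ∩ {z | s < gauge C z ∧ gauge C z ≤ t} = R t \ R s := by
    ext z
    simp only [R, mem_inter_iff, mem_setOf_eq, mem_diff, not_and, not_le]
    tauto
  rw [e, measure_sdiff hsub hm.nullMeasurableSet (by rw [hv s hs]; exact ENNReal.ofReal_ne_top),
    hv s hs, hv t (by linarith), ← ENNReal.ofReal_sub _ (by positivity)]
  apply ENNReal.ofReal_le_ofReal
  have h2 : (volume (R 1)).toReal ≤ 64 * |dt p q| * omegaVol 2 :=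
    ENNReal.toReal_le_of_le_ofReal (by have := om_pos; positivity) h1
  have h3 : 0 ≤ (volume (R 1)).toReal := ENNReal.toReal_nonneg
  have : t ^ 2 * (volume (R 1)).toReal - s ^ 2 * (volume (R 1)).toReal
    = (t + s) * (t - s) * (volume (R 1)).toReal := by ring
  rw [this]
  gcongr
  linarith

theorem layer {C : Set (Euc 2)} (hG : Good C) {p q : Euc 2} (hA : dt p q ≠ 0)
    {m X c : ℝ} (hm : 0 < m) (hX : 0 < X) (hc : 0 < c) :
    hMeasure C (wedge C p q ∩ {z | 1 / 2 < gauge C z ∧ m ≤ 1 - gauge C z ∧ 1 - gauge C z < X ∧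
      HP C z c}) ≤ ENNReal.ofReal (8 / (m * c) * (2 * X * (64 * |dt p q| * omegaVol 2))) := by
  have hω := om_pos
  by_cases hst : max (1 - X) (1 / 2) ≤ 1 - m
  · have hv := wedge_vol hG hA (s := max (1 - X) (1 / 2)) (t := 1 - m)
      (lt_max_of_lt_right (by norm_num)) (by linarith) hst
    have hgm : Measurable (gauge C) := hG.gcont.measurable
    have := hm_le (C := C) (T := wedge C p q ∩ {z | max (1 - X) (1 / 2) < gauge C z ∧
      gauge C z ≤ 1 - m} ∩ {z | HP C z c})
      (S := wedge C p q ∩ {z | 1 / 2 < gauge C z ∧ m ≤ 1 - gauge C z ∧ 1 - gauge C z < X ∧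
      HP C z c}) (B := ENNReal.ofReal (8 / (m * c)))
      (by
        rintro z ⟨h1, h2, h3, h4, h5⟩
        refine ⟨⟨h1, ?_, ?_⟩, h5⟩
        · exact max_lt (by linarith) h2
        · show gauge C z ≤ 1 - m
          linarith)
      (by
        refine ((wedge_closed hG p q).measurableSet.inter ?_).inter (HP_open hG.opn c).measurableSet
        exact (measurableSet_lt measurable_const hgm).inter (measurableSet_le hgm measurable_const))
      (by
        rintro z ⟨⟨h1, h2, h3⟩, h5⟩
        refine (dens1 hG hc h5).trans (ENNReal.ofReal_le_ofReal ?_)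
        have h3 : gauge C z ≤ 1 - m := h3
        have : m ≤ 1 - gauge C z := by linarith
        have := gauge_nonneg (s := C) z
        gcongr
        linarith)
    refine this.trans ?_
    rw [ENNReal.ofReal_mul (by positivity)]
    gcongr
    refine (measure_mono inter_subset_left).trans (hv.trans (ENNReal.ofReal_le_ofReal ?_))
    have := le_max_left (1 - X) (1 / 2)
    gcongr
    linarith
  · have : (wedge C p q ∩ {z | 1 / 2 < gauge C z ∧ m ≤ 1 - gauge C z ∧ 1 - gauge C z < X ∧
      HP C z c}) = ∅ := by
      rw [eq_empty_iff_forall_notMem]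
      rintro z ⟨h1, h2, h3, h4, h5⟩
      exact hst (max_le (by linarith) (by linarith))
    rw [this]; simp

theorem near_part {C V : Set (Euc 2)} (hG : Good C) (hV : V ⊆ C) {Δ : ℝ} (h0 : 0 < Δ)
    (h1 : Δ ≤ 1 / 8) (hD : ∀ p ∈ V, ∀ q ∈ V, hDist C p q ≤ Δ) :
    hMeasure C (coneS V ∩ {z | gauge C z ≤ 1 / 2}) ≤ ENNReal.ofReal (16384 * omegaVol 2 * Δ) := by
  rcases V.eq_empty_or_nonempty with rfl | hne
  · simp [coneS]
  obtain ⟨p, hp, q, hq, hpq⟩ := near_sup hG hV hne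
  by_cases hA : dt p q = 0
  · rw [hA] at hpq
    have : hMeasure C (coneS V) = 0 := cone_null fun x hx y hy => by
      have := hpq x hx y hy
      simpa using this
    rw [measure_mono_null inter_subset_left this]; exact zero_le
  have hω := om_pos
  have hpos : 0 < (volume C).toReal := ENNReal.toReal_pos
    (hG.opn.measure_pos volume ⟨0, hG.zero⟩).ne' hG.bdd.measure_lt_top.ne
  have hA' : 0 < |dt p q| := abs_pos.mpr hA
  have hAle : |dt p q| ≤ 64 * Δ * (volume C).toReal / omegaVol 2 := by
    rw [le_div_iff₀ hω]
    by_contra hcon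
    push Not at hcon
    obtain ⟨v, v1, v2, v3⟩ := (small_dist hG (hV hp) (hV hq) h0 h1 (hD p hp q hq)).2
      (16 * (volume C).toReal / omegaVol 2)
      (by rw [div_lt_div_iff₀ hω (by positivity)]; linarith)
    have h2 := det_le_vol hG (hV hp) v1
    rw [dt_add_right, dt_self, zero_add] at h2
    rw [div_lt_iff₀ hω] at v3
    have := le_abs_self (dt p v)
    nlinarith
  have c1 := dt_cont_left p
  have c2 := dt_cont_left q
  have c3 := hG.gcont
  let T : Set (Euc 2) := {z | gauge C z ≤ 1 / 2 ∧ |dt z q| ≤ 2 * |dt p q| ∧ |dt z p| ≤ 2 * |dt p q|}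
  have hT : MeasurableSet T :=
    ((isClosed_le c3 continuous_const).inter ((isClosed_le c2.abs continuous_const).inter
      (isClosed_le c1.abs continuous_const))).measurableSet
  have := hm_le (C := C) (S := coneS V ∩ {z | gauge C z ≤ 1 / 2}) (T := T)
    (B := ENNReal.ofReal (16 * omegaVol 2 / (volume C).toReal)) (by
      rintro _ ⟨⟨r, hr, x, hx0, hx1, rfl⟩, hz⟩
      refine ⟨hz, ?_, ?_⟩
      · have := hpq r hr q hq
        rw [dt_smul_left, abs_mul, abs_of_nonneg hx0]
        nlinarith [abs_nonneg (dt r q)]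
      · have := hpq r hr p hp
        rw [dt_smul_left, abs_mul, abs_of_nonneg hx0]
        nlinarith [abs_nonneg (dt r p)]) hT (fun z hz => dens2 hG hz.1)
  refine this.trans ?_
  have hvT := vol_para hA (k := 2) (by norm_num) (S := T) (fun z hz => hz.2)
  calc _ ≤ ENNReal.ofReal (16 * omegaVol 2 / (volume C).toReal) *
        ENNReal.ofReal (|dt p q| * (2 * 2) ^ 2 * omegaVol 2) := by gcongr
    _ ≤ _ := by
      rw [← ENNReal.ofReal_mul (by positivity)]
      apply ENNReal.ofReal_le_ofReal
      calc _ ≤ 16 * omegaVol 2 / (volume C).toReal *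
            ((64 * Δ * (volume C).toReal / omegaVol 2) * (2 * 2) ^ 2 * omegaVol 2) := by gcongr
        _ = _ := by field_simp; norm_num

theorem geom_sum (E : ℝ) (hE : 0 < E) (B : ℝ) (hB : 0 ≤ B) :
    ∑' j : ℕ, ENNReal.ofReal (B / (1 + 1 / E) ^ j) = ENNReal.ofReal (B * (E + 1)) := by
  have h1 : ∀ j : ℕ, B / (1 + 1 / E) ^ j = B * ((1 + 1 / E)⁻¹) ^ j := by
    intro j; rw [inv_pow]; rfl
  have hlt : (1 + 1 / E)⁻¹ < 1 := inv_lt_one_of_one_lt₀ (by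
    have : 0 < 1 / E := by positivity
    linarith)
  have hs := (hasSum_geometric_of_lt_one (by positivity) hlt).mul_left B
  simp_rw [h1]
  rw [← ENNReal.ofReal_tsum_of_nonneg (fun j => by positivity) hs.summable, hs.tsum_eq]
  congr 2
  field_simp
  ring

theorem far_part {C V : Set (Euc 2)} (hG : Good C) {δ : ℝ} (hδ : 0 ≤ δ) (hyp : IsDeltaHyp C δ)
    (hV : V ⊆ C) (hV2 : ∀ q ∈ V, 1 / 2 < gauge C q) {Δ : ℝ} (h0 : 0 < Δ)
    (h1 : Δ ≤ 1 / 8) (hD : ∀ p ∈ V, ∀ q ∈ V, hDist C p q ≤ Δ) :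
    hMeasure C (coneS V ∩ {z | 1 / 2 < gauge C z}) ≤
      ENNReal.ofReal (540672 * omegaVol 2 * Δ) +
      ENNReal.ofReal (135168 * (1 + 16 * EE δ) * omegaVol 2 * Δ * (EE δ + 1)) := by
  rcases V.eq_empty_or_nonempty with rfl | hne
  · simp [coneS]
  obtain ⟨p, hp, q, hq, hpq⟩ := near_sup hG hV hne
  by_cases hA : dt p q = 0
  · rw [hA] at hpq
    have : hMeasure C (coneS V) = 0 := cone_null fun x hx y hy => by
      have := hpq x hx y hy
      simpa using this
    rw [measure_mono_null inter_subset_left this]; exact zero_le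
  have hω := om_pos
  have hE := EE_ge hδ
  have hA' : 0 < |dt p q| := abs_pos.mpr hA
  obtain ⟨ρ, hρ⟩ : ∃ ρ, ρ = 1 - gauge C p := ⟨_, rfl⟩
  have gp := hG.gmem.mpr (hV hp)
  have hρ0 : 0 < ρ := by linarith
  obtain ⟨c, hc⟩ : ∃ c, c = |dt p q| / (33 * Δ) := ⟨_, rfl⟩
  have hc0 : 0 < c := by rw [hc]; positivity
  have hc1 : c < |dt p q| / 8 / (4 * Δ) := by
    rw [hc, div_div, div_lt_div_iff₀ (by positivity) (by positivity)]
    nlinarith [mul_pos hA' h0]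
  have hHP : ∀ r ∈ V, HP C r c := by
    intro r hr
    have hor : |dt p q| / 8 ≤ |dt r q| ∨ |dt p q| / 8 ≤ |dt r p| := by
      by_contra hcon
      push Not at hcon
      obtain ⟨k1, k2⟩ := hcon
      have gs : ∀ (a : ℝ) (w : Euc 2), w ∈ C → gauge C (a • w) ≤ 2 * |a| := by
        intro a w hw
        have gw := hG.gmem.mpr hw
        have gw0 : 0 ≤ gauge C w := gauge_nonneg w
        rcases le_total 0 a with h | h
        · rw [Good.gsmul h, abs_of_nonneg h]; nlinarith
        · rw [abs_of_nonpos h]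
          have : a • w = (-a) • (-w) := by simp
          rw [this, Good.gsmul (by linarith)]
          have := mul_le_mul_of_nonneg_left (hG.gneg w) (neg_nonneg.mpr h)
          nlinarith
      have e : r = (dt r q / dt p q) • p + (dt p r / dt p q) • q := by
        have := cramer2 p q r
        have h3 : r = (dt p q)⁻¹ • (dt p q • r) := by
          rw [smul_smul, inv_mul_cancel₀ hA, one_smul]
        conv_lhs => rw [h3, this]
        simp [smul_smul, smul_add, div_eq_inv_mul]
      have g1 := hG.gadd ((dt r q / dt p q) • p) ((dt p r / dt p q) • q)
      rw [← e] at g1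
      have g2 := gs (dt r q / dt p q) p (hV hp)
      have g3 := gs (dt p r / dt p q) q (hV hq)
      have g4 := hV2 r hr
      have g5 : |dt r q / dt p q| < 1 / 8 := by
        rw [abs_div, div_lt_iff₀ hA']; linarith
      have g6 : |dt p r / dt p q| < 1 / 8 := by
        rw [abs_div, div_lt_iff₀ hA', dt_swap p r, abs_neg]; linarith
      linarith
    rcases hor with h | h
    · refine (small_dist hG (hV hr) (hV hq) h0 h1 (hD r hr q hq)).2 c (hc1.trans_le ?_)
      gcongr
    · refine (small_dist hG (hV hr) (hV hp) h0 h1 (hD r hr p hp)).2 c (hc1.trans_le ?_)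
      gcongr
  have hρ1 : ∀ r ∈ V, ρ / 2 ≤ 1 - gauge C r ∧ 1 - gauge C r ≤ 2 * ρ := by
    intro r hr
    have a := (small_dist hG (hV hp) (hV hr) h0 h1 (hD p hp r hr)).1
    have b := (small_dist hG (hV hr) (hV hp) h0 h1 (hD r hr p hp)).1
    constructor <;> linarith
  have HPm : ∀ {z : Euc 2} {a b : ℝ}, HP C z a → b ≤ a → HP C z b := by
    rintro z a b ⟨v, v1, v2, v3⟩ hab
    exact ⟨v, v1, v2, hab.trans_lt v3⟩
  let L0 : Set (Euc 2) := wedge C p q ∩ {z | 1 / 2 < gauge C z ∧ ρ / 2 ≤ 1 - gauge C z ∧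
    1 - gauge C z < 2 * ρ ∧ HP C z (c / 4)}
  let L : ℕ → Set (Euc 2) := fun j => wedge C p q ∩ {z | 1 / 2 < gauge C z ∧
    2 * ρ * (1 + 16 * EE δ) ^ j ≤ 1 - gauge C z ∧
    1 - gauge C z < 2 * ρ * (1 + 16 * EE δ) ^ j * (1 + 16 * EE δ) ∧
    HP C z ((1 + 1 / EE δ) ^ j * c / 4)}
  have hcov : coneS V ∩ {z | 1 / 2 < gauge C z} ⊆ L0 ∪ ⋃ j, L j := by
    rintro z ⟨⟨r, hr, x, hx0, hx1, hzr⟩, hz⟩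
    have hz : 1 / 2 < gauge C z := hz
    have gzr : gauge C z = x * gauge C r := by rw [hzr, Good.gsmul hx0]
    have gr := hG.gmem.mpr (hV hr)
    have gr2 := hV2 r hr
    have hx : 1 / 2 < x := by nlinarith
    have hx2 : 1 / 4 ≤ x ^ 2 := by nlinarith
    obtain ⟨r1, r2⟩ := hρ1 r hr
    have hgz : gauge C z ≤ gauge C r := by nlinarith
    have hW : z ∈ wedge C p q := by
      constructor
      · have := hpq r hr q hq
        rw [hzr, dt_smul_left, abs_mul, abs_of_nonneg hx0, ← hzr]
        nlinarith [abs_nonneg (dt r q)]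
      · have := hpq r hr p hp
        rw [hzr, dt_smul_left, abs_mul, abs_of_nonneg hx0, ← hzr]
        nlinarith [abs_nonneg (dt r p)]
    by_cases hcase : 1 - gauge C z < 2 * ρ
    · left
      refine ⟨hW, hz, by linarith, hcase, ?_⟩
      have := HP_scale hG (hHP r hr) (x := x) (by linarith) hx1
      rw [← hzr] at this
      exact HPm this (by nlinarith)
    · right
      push Not at hcase
      obtain ⟨j, j1, j2⟩ := exists_nat_pow_near (x := (1 - gauge C z) / (2 * ρ))
        (y := 1 + 16 * EE δ) (by rw [le_div_iff₀ (by positivity)]; linarith) (by linarith)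
      rw [le_div_iff₀ (by positivity)] at j1
      rw [div_lt_iff₀ (by positivity), pow_succ] at j2
      refine mem_iUnion.mpr ⟨j, hW, hz, by linarith, by linarith, ?_⟩
      have hP : 0 < (1 + 16 * EE δ) ^ j := by positivity
      have := HP_iter hG hδ hyp j (hHP r hr) (x := x) (by linarith) hx1 (by
        rw [← hzr]
        refine le_trans ?_ j1
        gcongr)
      rw [← hzr] at this
      refine HPm this ?_
      have : 0 < (1 + 1 / EE δ) ^ j * c := by positivity
      nlinarith
  refine (measure_mono hcov).trans ((measure_union_le _ _).trans ?_)
  gcongr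
  · refine (layer hG hA (by positivity) (by positivity) (by positivity)).trans
      (ENNReal.ofReal_le_ofReal (le_of_eq ?_))
    rw [hc]; field_simp; norm_num
  · refine (measure_iUnion_le _).trans ?_
    rw [← geom_sum (EE δ) (by linarith) _ (by positivity)]
    refine ENNReal.tsum_le_tsum fun j => ?_
    refine (layer hG hA (by positivity) (by positivity) (by positivity)).trans
      (ENNReal.ofReal_le_ofReal (le_of_eq ?_))
    rw [hc]
    have : 0 < (1 + 16 * EE δ) ^ j := by positivity
    have : 0 < (1 + 1 / EE δ) ^ j := by positivity
    generalize (1 + 16 * EE δ) ^ j = P at *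
    generalize (1 + 1 / EE δ) ^ j = Q at *
    field_simp; norm_num

/-- constant in the cone inequality -/
noncomputable def Kc (δ : ℝ) : ℝ :=
  omegaVol 2 * (557056 + 135168 * (1 + 16 * EE δ) * (EE δ + 1))

theorem Kc_pos {δ : ℝ} (hδ : 0 ≤ δ) : 0 < Kc δ := by
  have := om_pos
  have := EE_ge hδ
  unfold Kc; positivity

theorem cone_le {C V : Set (Euc 2)} (hG : Good C) {δ : ℝ} (hδ : 0 ≤ δ) (hyp : IsDeltaHyp C δ)
    (hV : V ⊆ C) {Δ : ℝ} (h0 : 0 < Δ)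
    (h1 : Δ ≤ 1 / 8) (hD : ∀ p ∈ V, ∀ q ∈ V, hDist C p q ≤ Δ) :
    hMeasure C (coneS V) ≤ ENNReal.ofReal (Kc δ * Δ) := by
  have hω := om_pos
  have hE := EE_ge hδ
  have a := near_part hG hV h0 h1 hD
  have b := far_part hG hδ hyp (V := V ∩ {q | 1 / 2 < gauge C q}) (fun q hq => hV hq.1)
    (fun q hq => hq.2) h0 h1 (fun p hp q hq => hD p hp.1 q hq.1)
  have hsub : coneS V ⊆ (coneS V ∩ {z | gauge C z ≤ 1 / 2}) ∪
      (coneS (V ∩ {q | 1 / 2 < gauge C q}) ∩ {z | 1 / 2 < gauge C z}) := by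
    rintro z ⟨r, hr, x, hx0, hx1, hzr⟩
    by_cases hz : gauge C z ≤ 1 / 2
    · exact Or.inl ⟨⟨r, hr, x, hx0, hx1, hzr⟩, hz⟩
    · push Not at hz
      refine Or.inr ⟨⟨r, ⟨hr, ?_⟩, x, hx0, hx1, hzr⟩, hz⟩
      have gzr : gauge C z = x * gauge C r := by rw [hzr, Good.gsmul hx0]
      have := gauge_nonneg (s := C) r
      show 1 / 2 < gauge C r
      nlinarith
  refine (measure_mono hsub).trans ((measure_union_le _ _).trans ((add_le_add a b).trans ?_))
  rw [← ENNReal.ofReal_add (by positivity) (by positivity),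
    ← ENNReal.ofReal_add (by positivity) (by positivity)]
  apply ENNReal.ofReal_le_ofReal
  unfold Kc
  nlinarith

theorem subset_cone {U : Set (Euc 2)} (hU : IsOpen U) (hb : Bornology.IsBounded U)
    (hne : U.Nonempty) : U ⊆ coneS (frontier U) := by
  have hU1 : U ≠ univ := by
    rintro rfl
    exact NormedSpace.unbounded_univ ℝ (Euc 2) hb
  intro x hx
  by_cases hx0 : x = 0
  · obtain ⟨q, hq⟩ := nonempty_frontier_iff.mpr ⟨hne, hU1⟩
    exact ⟨q, hq, 0, le_rfl, zero_le_one, by simp [hx0]⟩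
  by_contra hcon
  let S : Set (Euc 2) := (fun t : ℝ => t • x) '' Ici 1
  have hS : IsPreconnected S := isPreconnected_Ici.image _ (by fun_prop)
  have hSU : S ⊆ U := by
    refine hS.subset_left_of_subset_union hU isClosed_closure.isOpen_compl
      (disjoint_compl_right.mono_left subset_closure) ?_ ⟨x, ⟨1, mem_Ici.mpr le_rfl, one_smul _ _⟩, hx⟩
    rintro _ ⟨t, ht, rfl⟩
    have ht : (1 : ℝ) ≤ t := ht
    by_contra h
    simp only [mem_union, mem_compl_iff, not_or, not_not] at h
    apply hcon
    refine ⟨t • x, ⟨h.2, by rw [hU.interior_eq]; exact h.1⟩, t⁻¹, by positivity,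
      inv_le_one_of_one_le₀ ht, ?_⟩
    rw [smul_smul, inv_mul_cancel₀ (by positivity), one_smul]
  obtain ⟨R, hR⟩ := hb.exists_norm_le
  have hxn : 0 < ‖x‖ := norm_pos_iff.mpr hx0
  have h1 := hR _ (hSU ⟨1 + |R| / ‖x‖, by simp; positivity, rfl⟩)
  have h2 : 0 ≤ |R| / ‖x‖ := by positivity
  simp only [norm_smul, Real.norm_eq_abs] at h1
  rw [abs_of_nonneg (by positivity), add_mul, div_mul_cancel₀ _ hxn.ne'] at h1
  have := le_abs_self R
  linarith

theorem cone_diam {C V : Set (Euc 2)} (hG : Good C) {δ : ℝ} (hδ : 0 ≤ δ) (hyp : IsDeltaHyp C δ)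
    {F : Set (Euc 2)} (hF : F ⊆ C) (hd : ediamD (hDist C) V ≤ ENNReal.ofReal (1 / 8)) :
    hMeasure C (coneS (V ∩ F)) ≤ ENNReal.ofReal (Kc δ) * ediamD (hDist C) V := by
  have hK := Kc_pos hδ
  have hfin : ediamD (hDist C) V ≠ ⊤ := (hd.trans_lt ENNReal.ofReal_lt_top).ne
  have hle : ∀ p ∈ V, ∀ q ∈ V, hDist C p q ≤ (ediamD (hDist C) V).toReal := by
    intro p hp q hq
    rw [← ENNReal.ofReal_le_iff_le_toReal hfin]
    unfold ediamD
    exact le_iSup₂_of_le p hp (le_iSup₂_of_le (f := fun y _ => ENNReal.ofReal (hDist C p y)) q hq le_rfl)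
  have hd8 : (ediamD (hDist C) V).toReal ≤ 1 / 8 :=
    ENNReal.toReal_le_of_le_ofReal (by norm_num) hd
  have hd0 : 0 ≤ (ediamD (hDist C) V).toReal := ENNReal.toReal_nonneg
  rw [← ENNReal.ofReal_toReal hfin]
  generalize (ediamD (hDist C) V).toReal = d at *
  have key : ∀ Δ, 0 < Δ → Δ ≤ 1 / 8 → d ≤ Δ →
      hMeasure C (coneS (V ∩ F)) ≤ ENNReal.ofReal (Kc δ * Δ) := fun Δ h0 h1 h2 =>
    cone_le hG hδ hyp (fun x hx => hF hx.2) h0 h1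
      (fun p hp q hq => (hle p hp.1 q hq.1).trans h2)
  rcases hd0.eq_or_lt with h | h
  · subst h
    rw [ENNReal.ofReal_zero, mul_zero]
    refine ENNReal.le_of_forall_pos_le_add fun ε hε _ => ?_
    have hε' : (0 : ℝ) < ε := hε
    refine (key (min (1 / 8) (ε / Kc δ)) (by positivity) (min_le_left _ _) (by positivity)).trans ?_
    rw [zero_add, ← ENNReal.ofReal_coe_nnreal]
    apply ENNReal.ofReal_le_ofReal
    calc Kc δ * min (1 / 8) (ε / Kc δ) ≤ Kc δ * (ε / Kc δ) := by gcongr; exact min_le_right _ _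
      _ = ε := by field_simp
  · rw [← ENNReal.ofReal_mul hK.le]
    exact key d h hd8 le_rfl

theorem main_ineq {C : Set (Euc 2)} (hG : Good C) {δ : ℝ} (hδ : 0 ≤ δ) (hyp : IsDeltaHyp C δ)
    {U : Set (Euc 2)} (hU : IsOpen U) (hUC : closure U ⊆ C) :
    hMeasure C U ≤ ENNReal.ofReal (Kc δ) * hausD 1 (hDist C) (frontier U) := by
  rcases U.eq_empty_or_nonempty with rfl | hne
  · simp
  have hK := Kc_pos hδ
  have hcone := subset_cone hU (hG.bdd.subset (subset_closure.trans hUC)) hne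
  rw [← ENNReal.inv_mul_le_iff (by simpa using hK) ENNReal.ofReal_ne_top]
  unfold hausD
  refine le_iSup₂_of_le (ENNReal.ofReal (1 / 8)) (by simp) ?_
  refine le_iInf fun V => le_iInf fun hV => le_iInf fun hd => ?_
  rw [ENNReal.inv_mul_le_iff (by simpa using hK) ENNReal.ofReal_ne_top]
  have hsub : U ⊆ ⋃ i, coneS (V i ∩ frontier U) := by
    intro z hz
    obtain ⟨q, hq, x, h0, h1, hx⟩ := hcone hz
    obtain ⟨i, hi⟩ := mem_iUnion.mp (hV hq)
    exact mem_iUnion.mpr ⟨i, q, ⟨hi, hq⟩, x, h0, h1, hx⟩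
  refine (measure_mono hsub).trans ((measure_iUnion_le _).trans ?_)
  rw [← ENNReal.tsum_mul_left]
  refine ENNReal.tsum_le_tsum fun i => ?_
  rw [ENNReal.rpow_one]
  exact cone_diam hG hδ hyp (frontier_subset_closure.trans hUC) (hd i)

theorem center {C : Set (Euc 2)} (hc : Convex ℝ C) (ho : IsOpen C) (hb : Bornology.IsBounded C)
    (hne : C.Nonempty) : ∃ o ∈ C, ∀ z ∈ C, o - (1 / 2 : ℝ) • (z - o) ∈ C := by
  have hK : IsCompact (closure C) := hb.isCompact_closure
  obtain ⟨x0, hx0⟩ := hne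
  let f : Euc 2 × Euc 2 × Euc 2 → ℝ := fun t => |dt (t.2.1 - t.1) (t.2.2 - t.1)|
  have hf : Continuous f := by
    unfold f dt; fun_prop
  obtain ⟨⟨a, b, c⟩, ⟨ha, hb', hc'⟩, hmax⟩ := (hK.prod (hK.prod hK)).exists_isMaxOn
    ⟨(x0, x0, x0), subset_closure hx0, subset_closure hx0, subset_closure hx0⟩ hf.continuousOn
  have hmax' : ∀ u ∈ closure C, ∀ v ∈ closure C, ∀ w ∈ closure C,
      |dt (v - u) (w - u)| ≤ |dt (b - a) (c - a)| := fun u hu v hv w hw =>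
    hmax (show (u, v, w) ∈ closure C ×ˢ (closure C ×ˢ closure C) from ⟨hu, hv, hw⟩)
  have hD : dt (b - a) (c - a) ≠ 0 := by
    intro h0
    obtain ⟨r, hr, hball⟩ := Metric.isOpen_iff.mp ho x0 hx0
    have e : ∀ v : Euc 2, ‖v‖ ≤ 1 → x0 + (r / 2) • v ∈ closure C := by
      intro v hv
      apply subset_closure; apply hball
      rw [mem_ball_iff_norm, add_sub_cancel_left, norm_smul, Real.norm_eq_abs,
        abs_of_pos (by positivity)]
      nlinarith
    have := hmax' x0 (subset_closure hx0) _ (e (EuclideanSpace.single 0 1) (by simp))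
      _ (e (EuclideanSpace.single 1 1) (by simp))
    rw [h0, add_sub_cancel_left, add_sub_cancel_left, dt_smul_left, dt_smul_right] at this
    simp [dt] at this
    nlinarith
  set D := dt (b - a) (c - a) with hDdef
  have hDp : 0 < |D| := abs_pos.mpr hD
  obtain ⟨o, hoe⟩ : ∃ o : Euc 2, o = (1 / 3 : ℝ) • (a + b + c) := ⟨_, rfl⟩
  have hcl : ∀ w ∈ closure C, o - (1 / 2 : ℝ) • (w - o) ∈ closure C := by
    intro w hw
    obtain ⟨la, hla⟩ : ∃ la, la = dt (b - w) (c - w) / D := ⟨_, rfl⟩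
    obtain ⟨lb, hlb⟩ : ∃ lb, lb = dt (w - a) (c - a) / D := ⟨_, rfl⟩
    obtain ⟨lc, hlc⟩ : ∃ lc, lc = dt (b - a) (w - a) / D := ⟨_, rfl⟩
    have ba : la ≤ 1 := by
      refine (le_abs_self _).trans ?_
      rw [hla, abs_div, div_le_one hDp]; exact hmax' w hw b hb' c hc'
    have bb : lb ≤ 1 := by
      refine (le_abs_self _).trans ?_
      rw [hlb, abs_div, div_le_one hDp]; exact hmax' a ha w hw c hc'
    have bc : lc ≤ 1 := by
      refine (le_abs_self _).trans ?_
      rw [hlc, abs_div, div_le_one hDp]; exact hmax' a ha b hb' w hw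
    have hsum : la + lb + lc = 1 := by
      rw [hla, hlb, hlc, ← add_div, ← add_div, div_eq_one_iff_eq hD, hDdef]
      simp [dt]; ring
    have hw' : w = la • a + lb • b + lc • c := by
      have h1 : D • w = dt (b - w) (c - w) • a + dt (w - a) (c - a) • b + dt (b - a) (w - a) • c := by
        ext i; fin_cases i <;> simp [dt, hDdef] <;> ring
      have h2 : w = D⁻¹ • (D • w) := by rw [smul_smul, inv_mul_cancel₀ hD, one_smul]
      rw [hla, hlb, hlc]
      conv_lhs => rw [h2, h1]
      simp only [smul_add, smul_smul, div_eq_inv_mul]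
    have hconv := hc.closure
    have e : o - (1 / 2 : ℝ) • (w - o) = ((1 - la) / 2) • a + ((1 - lb) / 2) • b + ((1 - lc) / 2) • c := by
      rw [hoe]; nth_rw 1 [hw']; module
    rw [e]
    have := hconv.sum_mem (t := Finset.univ) (w := ![(1 - la) / 2, (1 - lb) / 2, (1 - lc) / 2])
      (z := ![a, b, c]) (by intro i _; fin_cases i <;> simp <;> linarith)
      (by simp [Fin.sum_univ_three]; linarith)
      (by intro i _; fin_cases i <;> simp <;> assumption)
    simpa [Fin.sum_univ_three] using this
  have hoC : o ∈ C := by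
    have := hc.combo_interior_closure_mem_interior (x := x0) (by rwa [ho.interior_eq])
      (hcl x0 (subset_closure hx0)) (a := 1 / 3) (b := 2 / 3) (by norm_num) (by norm_num) (by norm_num)
    rw [ho.interior_eq] at this
    convert this using 1
    module
  refine ⟨o, hoC, fun z hz => ?_⟩
  have hev : ∀ᶠ t : ℝ in nhds 1, o + t • (z - o) ∈ C :=
    (ho.preimage (f := fun t : ℝ => o + t • (z - o)) (by fun_prop)).mem_nhds
      (by simpa using hz)
  obtain ⟨t, ht1, ht⟩ := ((hev.filter_mono nhdsWithin_le_nhds).and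
    (self_mem_nhdsWithin (a := (1:ℝ)) (s := Ioi 1))).exists
  have ht : 1 < t := ht
  have hz' := hcl _ (subset_closure ht1)
  have := hc.combo_interior_closure_mem_interior (x := o) (by rwa [ho.interior_eq])
      hz' (a := 1 - t⁻¹) (b := t⁻¹) (by have := inv_lt_one_of_one_lt₀ ht; linarith)
      (by positivity) (by ring)
  rw [ho.interior_eq] at this
  convert this using 1
  have : t⁻¹ * t = 1 := inv_mul_cancel₀ (by positivity)
  have e : t⁻¹ • (o - (1 / 2 : ℝ) • (o + t • (z - o) - o)) = t⁻¹ • o - (1 / 2 * (t⁻¹ * t)) • (z - o) := by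
    module
  rw [e, this]; module

theorem lp_pre {m n : ℕ} (φ : Euc m →ᵃⁱ[ℝ] Euc n) (C : Set (Euc n)) (p q : Euc m) :
    lineParams (φ ⁻¹' C) p (q - p) = lineParams C (φ p) (φ q - φ p) := by
  ext t
  simp only [lineParams, mem_preimage]
  have : φ (p + t • (q - p)) = φ p + t • (φ q - φ p) := by
    have h := φ.map_vadd p (t • (q - p))
    have h2 := φ.toAffineMap.linearMap_vsub q p
    simp only [vadd_eq_add] at h
    rw [add_comm, h]
    rw [map_smul, add_comm]
    congr 2
  change φ (p + t • (q - p)) ∈ C ↔ φ p + t • (φ q - φ p) ∈ C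
  rw [this]

theorem hDist_pre {m n : ℕ} (φ : Euc m →ᵃⁱ[ℝ] Euc n) (C : Set (Euc n)) (p q : Euc m) :
    hDist (φ ⁻¹' C) p q = hDist C (φ p) (φ q) := by
  unfold hDist
  rw [lp_pre]
  simp only [φ.injective.eq_iff]

theorem hyp_pre {m n : ℕ} (φ : Euc m →ᵃⁱ[ℝ] Euc n) {C : Set (Euc n)} {δ : ℝ}
    (h : IsDeltaHyp C δ) : IsDeltaHyp (φ ⁻¹' C) δ := by
  intro x hx y hy z hz t ht
  have := h _ hx _ hy _ hz _ ht
  simp only [gromovProd, hDist_pre] at *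
  exact this

theorem hausD_pre {m n : ℕ} (φ : Euc m →ᵃⁱ[ℝ] Euc n) (C S : Set (Euc n)) :
    hausD 1 (hDist (φ ⁻¹' C)) (φ ⁻¹' S) ≤ hausD 1 (hDist C) S := by
  unfold hausD
  refine iSup₂_mono fun ε hε => ?_
  refine le_iInf fun V => le_iInf fun hV => le_iInf fun hd => ?_
  have hle : ∀ i, ediamD (hDist (φ ⁻¹' C)) (φ ⁻¹' V i) ≤ ediamD (hDist C) (V i) := by
    intro i
    unfold ediamD
    refine iSup₂_le fun x hx => iSup₂_le fun y hy => ?_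
    rw [hDist_pre]
    exact le_iSup₂_of_le (φ x) hx
      (le_iSup₂_of_le (f := fun y _ => ENNReal.ofReal (hDist C (φ x) y)) (φ y) hy le_rfl)
  refine iInf_le_of_le (fun i => φ ⁻¹' V i) (iInf_le_of_le ?_ (iInf_le_of_le ?_ ?_))
  · rw [← preimage_iUnion]; exact preimage_mono hV
  · exact fun i => (hle i).trans (hd i)
  · exact ENNReal.tsum_le_tsum fun i => ENNReal.rpow_le_rpow (hle i) zero_le_one

theorem main_ineq2 {C : Set (Euc 2)} (hc : Convex ℝ C) (ho : IsOpen C)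
    (hb : Bornology.IsBounded C) (hne : C.Nonempty)
    {δ : ℝ} (hδ : 0 ≤ δ) (hyp : IsDeltaHyp C δ)
    {U : Set (Euc 2)} (hU : IsOpen U) (hUC : closure U ⊆ C) :
    hMeasure C U ≤ ENNReal.ofReal (Kc δ) * hausD 1 (hDist C) (frontier U) := by
  obtain ⟨o, hoC, hcen⟩ := center hc ho hb hne
  let τ : Euc 2 →ᵃⁱ[ℝ] Euc 2 := (AffineIsometryEquiv.constVAdd ℝ (Euc 2) o).toAffineIsometry
  have hτ : ∀ x, τ x = o + x := fun x => rfl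
  have hτh : IsOpenMap (fun x => o + x) := isOpenMap_add_left o
  have hcont : Continuous τ := τ.continuous
  have hG : Good (τ ⁻¹' C) := by
    refine ⟨hc.affine_preimage τ.toAffineMap, ho.preimage hcont, ?_, ?_, ?_⟩
    · obtain ⟨R, hR⟩ := hb.exists_norm_le
      refine isBounded_iff_forall_norm_le.mpr ⟨R + ‖o‖, fun x hx => ?_⟩
      have := hR _ hx
      rw [hτ] at this
      have h2 := norm_sub_le (o + x) o
      rw [add_sub_cancel_left] at h2
      linarith
    · show τ 0 ∈ C
      rw [hτ, add_zero]; exact hoC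
    · intro z hz
      have hz : o + z ∈ C := hz
      have := hcen _ hz
      show o + (-(1/2) : ℝ) • z ∈ C
      convert this using 1; module
  have hfr : τ ⁻¹' frontier U = frontier (τ ⁻¹' U) :=
    (Homeomorph.addLeft o).preimage_frontier U
  have hcl : closure (τ ⁻¹' U) ⊆ τ ⁻¹' C :=
    (hcont.closure_preimage_subset U).trans (preimage_mono hUC)
  have h1 := main_ineq hG hδ (hyp_pre τ hyp) (hU.preimage hcont) hcl
  rw [← hfr] at h1
  have h2 : hMeasure C U = hMeasure (τ ⁻¹' C) (τ ⁻¹' U) := by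
    have htb : ∀ z, tangentBall (τ ⁻¹' C) z 1 = tangentBall C (τ z) 1 := by
      intro z
      have : ∀ u, lineParams (τ ⁻¹' C) z u = lineParams C (τ z) u := by
        intro u; ext t
        simp only [lineParams, mem_preimage, hτ, add_assoc]
      simp only [tangentBall, fNorm, this]
    unfold hMeasure
    rw [withDensity_apply _ hU.measurableSet, withDensity_apply _ (hU.preimage hcont).measurableSet,
      Measure.restrict_restrict hU.measurableSet,
      Measure.restrict_restrict (hU.preimage hcont).measurableSet, ← preimage_inter]
    simp only [htb]
    exact ((measurePreserving_add_left volume o).setLIntegral_comp_preimage_emb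
      (measurableEmbedding_addLeft o)
      (fun p => ENNReal.ofReal (omegaVol 2 / (volume (tangentBall C p 1)).toReal)) (U ∩ C)).symm
  rw [h2]
  refine h1.trans ?_
  gcongr
  exact hausD_pre τ C _

theorem hMeasure_pos {C : Set (Euc 2)} (ho : IsOpen C) (hb : Bornology.IsBounded C)
    {U : Set (Euc 2)} (hU : IsOpen U) (hne : U.Nonempty) (hUC : U ⊆ C) : 0 < hMeasure C U := by
  obtain ⟨R, hR⟩ := hb.exists_norm_le
  have hω := om_pos
  obtain ⟨x, hx⟩ := hne
  have hR0 : 0 ≤ R := (norm_nonneg x).trans (hR x (hUC hx))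
  have hMpos : 0 < (volume (Metric.ball (0 : Euc 2) (2 * R + 1))).toReal :=
    ENNReal.toReal_pos (Metric.measure_ball_pos volume _ (by positivity)).ne'
      measure_ball_lt_top.ne
  unfold hMeasure
  rw [withDensity_apply _ hU.measurableSet, Measure.restrict_restrict hU.measurableSet,
    inter_eq_self_of_subset_left hUC]
  have h1 : ∫⁻ _ in U, ENNReal.ofReal (omegaVol 2 /
      (volume (Metric.ball (0 : Euc 2) (2 * R + 1))).toReal) ≤
      ∫⁻ p in U, ENNReal.ofReal (omegaVol 2 / (volume (tangentBall C p 1)).toReal) := by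
    refine setLIntegral_mono' hU.measurableSet fun p hp => ENNReal.ofReal_le_ofReal ?_
    have hsub := tb_bdd ho hR (hUC hp)
    have hpos : 0 < (volume (tangentBall C p 1)).toReal := by
      refine ENNReal.toReal_pos ?_ (tb_fin ho hb (hUC hp))
      have hop : IsOpen ((fun v => p + v) ⁻¹' C ∩ (fun v => p - v) ⁻¹' C) :=
        (ho.preimage (by fun_prop)).inter (ho.preimage (by fun_prop))
      have h2 := hop.measure_pos volume ⟨0, by simpa using hUC hp⟩
      exact (h2.trans_le (measure_mono fun v hv => fNorm_lt_one ho hb hv.1 hv.2)).ne'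
    have := ENNReal.toReal_mono measure_ball_lt_top.ne (measure_mono (μ := volume) hsub)
    gcongr
  refine lt_of_lt_of_le ?_ h1
  rw [setLIntegral_const]
  refine ENNReal.mul_pos ?_ (hU.measure_pos volume ⟨x, hx⟩).ne'
  rw [Ne, ENNReal.ofReal_eq_zero, not_le]
  positivity

theorem hDist_lip {C : Set (Euc 2)} (ho : IsOpen C) (hb : Bornology.IsBounded C) {x0 : Euc 2}
    {r : ℝ} (hr : 0 < r) (hball : Metric.closedBall x0 (4 * r) ⊆ C) {p q : Euc 2}
    (hp : ‖p - x0‖ ≤ r) (hq : ‖q - x0‖ ≤ r) : hDist C p q ≤ ‖q - p‖ / (2 * r) := by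
  by_cases hpq : p = q
  · subst hpq; simp [hDist]
  have hn : 0 < ‖q - p‖ := norm_pos_iff.mpr (sub_ne_zero.mpr (Ne.symm hpq))
  obtain ⟨s, hs⟩ : ∃ s, s = 2 * r / ‖q - p‖ := ⟨_, rfl⟩
  have hs0 : 0 < s := by rw [hs]; positivity
  have hsn : ‖s • (q - p)‖ = 2 * r := by
    rw [norm_smul, Real.norm_eq_abs, abs_of_pos hs0, hs, div_mul_cancel₀ _ hn.ne']
  have h1 := hd_ub ho hb hpq hs0 hs0
    (by
      apply hball
      rw [mem_closedBall_iff_norm]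
      have e : p - s • (q - p) - x0 = (p - x0) - s • (q - p) := by abel
      have := norm_sub_le (p - x0) (s • (q - p))
      rw [e]; linarith)
    (by
      apply hball
      rw [mem_closedBall_iff_norm]
      have e : q + s • (q - p) - x0 = (q - x0) + s • (q - p) := by abel
      have := norm_add_le (q - x0) (s • (q - p))
      rw [e]; linarith)
  refine h1.trans ?_
  rw [Real.log_mul (by positivity) (by positivity)]
  have e : (1 + s) / s = 1 / s + 1 := by field_simp
  have h2 := Real.log_le_sub_one_of_pos (x := (1 + s) / s) (by positivity)
  have h3 : 1 / s = ‖q - p‖ / (2 * r) := by rw [hs]; field_simp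
  linarith

theorem hausD_lip {d : Euc 2 → Euc 2 → ℝ} {c : ℝ → Euc 2} {L : ℝ} (hL : 0 < L)
    (h : ∀ s ∈ Icc (0:ℝ) 1, ∀ t ∈ Icc (0:ℝ) 1, d (c s) (c t) ≤ L * |s - t|) :
    hausD 1 d (c '' Icc (0:ℝ) 1) ≤ ENNReal.ofReal L := by
  unfold hausD
  refine iSup₂_le fun ε hε => ?_
  obtain ⟨η, hη0, hη⟩ : ∃ η : ℝ, 0 < η ∧ ENNReal.ofReal η ≤ ε := by
    by_cases ht : ε = ⊤
    · exact ⟨1, one_pos, by rw [ht]; exact le_top⟩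
    · exact ⟨ε.toReal, ENNReal.toReal_pos hε.ne' ht, by rw [ENNReal.ofReal_toReal ht]⟩
  obtain ⟨N, hN⟩ := exists_nat_gt (L / η)
  have hN0 : (0:ℝ) < N := lt_trans (by positivity) hN
  have hNη : L / N ≤ η := by
    rw [div_lt_iff₀ hη0] at hN
    rw [div_le_iff₀ hN0]; linarith
  let V : ℕ → Set (Euc 2) := fun i =>
    if i < N then c '' (Icc (i / N : ℝ) ((i + 1) / N) ∩ Icc 0 1) else ∅
  have hd : ∀ i, ediamD d (V i) ≤ if i < N then ENNReal.ofReal (L / N) else 0 := by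
    intro i
    by_cases hi : i < N
    · simp only [V, hi, if_true]
      refine iSup₂_le fun x hx => iSup₂_le fun y hy => ?_
      obtain ⟨s, ⟨hs1, hs2⟩, rfl⟩ := hx
      obtain ⟨t, ⟨ht1, ht2⟩, rfl⟩ := hy
      refine ENNReal.ofReal_le_ofReal ((h s hs2 t ht2).trans ?_)
      have : |s - t| ≤ 1 / N := by
        have e : ((i:ℝ) + 1) / N = i / N + 1 / N := by ring
        obtain ⟨a1, a2⟩ := hs1
        obtain ⟨b1, b2⟩ := ht1
        rw [abs_le]; constructor <;> linarith
      calc L * |s - t| ≤ L * (1 / N) := by gcongr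
        _ = L / N := by ring
    · simp [V, hi, ediamD]
  refine iInf_le_of_le V (iInf_le_of_le ?_ (iInf_le_of_le ?_ ?_))
  · rintro _ ⟨t, ht, rfl⟩
    obtain ⟨t0, t1⟩ := ht
    rcases t1.eq_or_lt with h1 | h1
    · refine mem_iUnion.mpr ⟨N - 1, ?_⟩
      have hN1 : 0 < N := by exact_mod_cast hN0
      have hlt : N - 1 < N := by omega
      have hcast : ((N - 1 : ℕ) : ℝ) = N - 1 := by
        rw [Nat.cast_sub hN1]; simp
      simp only [V, hlt, if_true, hcast]
      refine ⟨t, ⟨⟨?_, ?_⟩, t0, t1⟩, rfl⟩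
      · rw [div_le_iff₀ hN0, h1]; linarith
      · rw [le_div_iff₀ hN0, h1]; linarith
    · refine mem_iUnion.mpr ⟨⌊t * N⌋₊, ?_⟩
      have hp : 0 ≤ t * N := by positivity
      have hlt : ⌊t * N⌋₊ < N := by
        rw [Nat.floor_lt hp]; nlinarith
      simp only [V, hlt, if_true]
      refine ⟨t, ⟨⟨?_, ?_⟩, t0, t1⟩, rfl⟩
      · rw [div_le_iff₀ hN0]; exact Nat.floor_le hp
      · rw [le_div_iff₀ hN0]; exact (Nat.lt_floor_add_one _).le
  · intro i
    refine (hd i).trans ?_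
    split_ifs
    · exact (ENNReal.ofReal_le_ofReal hNη).trans hη
    · exact zero_le
  · simp only [ENNReal.rpow_one]
    refine (ENNReal.tsum_le_tsum hd).trans ?_
    rw [tsum_eq_sum (s := Finset.range N) (by
      intro b hb
      rw [Finset.mem_range] at hb
      exact if_neg hb)]
    rw [Finset.sum_congr rfl (g := fun _ => ENNReal.ofReal (L / N))
      (by intro i hi; simp [Finset.mem_range.mp hi])]
    rw [Finset.sum_const, Finset.card_range, nsmul_eq_mul, ← ENNReal.ofReal_natCast,
      ← ENNReal.ofReal_mul hN0.le]
    apply ENNReal.ofReal_le_ofReal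
    apply le_of_eq; field_simp

theorem ball_rect {C : Set (Euc 2)} (ho : IsOpen C) (hb : Bornology.IsBounded C) {x0 : Euc 2}
    {r : ℝ} (hr : 0 < r) (hball : Metric.closedBall x0 (4 * r) ⊆ C) :
    RectCurveBoundary C (Metric.ball x0 r) := by
  let θ : ℝ → ℝ := fun t => 2 * Real.pi * t - Real.pi
  let c : ℝ → Euc 2 := fun t => x0 + r • !₂[Real.cos (θ t), Real.sin (θ t)]
  have hnorm : ∀ t, ‖c t - x0‖ = r := by
    intro t
    simp only [c]
    rw [add_sub_cancel_left, norm_smul, Real.norm_eq_abs, abs_of_pos hr, EuclideanSpace.norm_eq]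
    simp [Fin.sum_univ_two]
  have hlip : ∀ s t, ‖c t - c s‖ ≤ r * (4 * Real.pi * |s - t|) := by
    intro s t
    have e : c t - c s = r • !₂[Real.cos (θ t) - Real.cos (θ s), Real.sin (θ t) - Real.sin (θ s)] := by
      ext i; fin_cases i <;> simp [c] <;> ring
    rw [e, norm_smul, Real.norm_eq_abs, abs_of_pos hr]
    gcongr
    rw [EuclideanSpace.norm_eq]
    have hpi := Real.pi_pos
    apply Real.sqrt_le_iff.mpr ⟨by positivity, ?_⟩
    have h1 := Real.abs_cos_sub_cos_le (θ t) (θ s)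
    have h2 := Real.abs_sin_sub_sin_le (θ t) (θ s)
    have h3 : |θ t - θ s| = 2 * Real.pi * |s - t| := by
      have : θ t - θ s = 2 * Real.pi * (t - s) := by simp only [θ]; ring
      rw [this, abs_mul, abs_of_pos (by positivity), abs_sub_comm]
    rw [h3] at h1 h2
    have h4 := pow_le_pow_left₀ (abs_nonneg _) h1 2
    have h5 := pow_le_pow_left₀ (abs_nonneg _) h2 2
    simp only [Fin.sum_univ_two, Real.norm_eq_abs]
    simp only [Matrix.cons_val_zero, Matrix.cons_val_one]
    nlinarith [sq_nonneg (Real.pi * |s - t|)]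
  have hcont : Continuous c := by
    have : Continuous fun t => (!₂[Real.cos (θ t), Real.sin (θ t)] : Euc 2) := by
      refine (PiLp.continuous_toLp 2 _).comp (continuous_pi fun i => ?_)
      fin_cases i
      · show Continuous fun t => Real.cos (2 * Real.pi * t - Real.pi); fun_prop
      · show Continuous fun t => Real.sin (2 * Real.pi * t - Real.pi); fun_prop
    exact continuous_const.add (this.const_smul r)
  have himg : c '' Icc (0:ℝ) 1 = frontier (Metric.ball x0 r) := by
    rw [frontier_ball x0 hr.ne']
    ext y
    constructor
    · rintro ⟨t, -, rfl⟩
      rw [mem_sphere_iff_norm]; exact hnorm t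
    · intro hy
      rw [mem_sphere_iff_norm] at hy
      have hpi := Real.pi_pos
      let z : ℂ := ⟨(y - x0) 0, (y - x0) 1⟩
      have hz : ‖z‖ = r := by
        rw [← hy, EuclideanSpace.norm_eq, Complex.norm_eq_sqrt_sq_add_sq]
        simp [Fin.sum_univ_two, z]
      refine ⟨(Complex.arg z + Real.pi) / (2 * Real.pi), ⟨?_, ?_⟩, ?_⟩
      · have := Complex.neg_pi_lt_arg z
        apply div_nonneg <;> linarith
      · have := Complex.arg_le_pi z
        rw [div_le_one (by positivity)]; linarith
      · have hθ : θ ((Complex.arg z + Real.pi) / (2 * Real.pi)) = Complex.arg z := by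
          simp only [θ]; field_simp; ring
        simp only [c, hθ]
        have h1 := Complex.norm_mul_cos_arg z
        have h2 := Complex.norm_mul_sin_arg z
        rw [hz] at h1 h2
        ext i; fin_cases i
        · change x0 0 + r * Real.cos z.arg = y 0
          have h3 : z.re = y 0 - x0 0 := rfl
          linarith
        · change x0 1 + r * Real.sin z.arg = y 1
          have h3 : z.im = y 1 - x0 1 := rfl
          linarith
  have hd : ∀ s ∈ Icc (0:ℝ) 1, ∀ t ∈ Icc (0:ℝ) 1,
      hDist C (c s) (c t) ≤ (2 * Real.pi) * |s - t| := by
    intro s _ t _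
    refine (hDist_lip ho hb hr hball (hnorm s).le (hnorm t).le).trans ?_
    rw [div_le_iff₀ (by positivity)]
    have := hlip s t
    linarith
  refine ⟨c, hcont.continuousOn, himg, ?_, ?_⟩
  · have : θ 0 = -Real.pi := by simp [θ]
    have h1 : θ 1 = Real.pi := by simp only [θ]; ring
    simp [c, this, h1]
  · rw [← himg]
    exact (hausD_lip (by have := Real.pi_pos; positivity) hd).trans_lt ENNReal.ofReal_lt_top

theorem cheeger_ge {C : Set (Euc 2)} (hc : Convex ℝ C) (ho : IsOpen C)
    (hb : Bornology.IsBounded C) (hne : C.Nonempty)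
    {δ : ℝ} (hδ : 0 ≤ δ) (hyp : IsDeltaHyp C δ) : 1 / Kc δ ≤ cheeger2 C := by
  have hK := Kc_pos hδ
  unfold cheeger2 cheeger2D
  apply le_csInf
  · obtain ⟨x0, hx0⟩ := hne
    obtain ⟨ε, hε, hball⟩ := Metric.isOpen_iff.mp ho x0 hx0
    have h4 : Metric.closedBall x0 (4 * (ε / 8)) ⊆ C :=
      (Metric.closedBall_subset_ball (by linarith)).trans hball
    refine ⟨_, Metric.ball x0 (ε / 8), Metric.isOpen_ball, ⟨x0, Metric.mem_ball_self (by positivity)⟩,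
      ?_, ball_rect ho hb (by positivity) h4, rfl⟩
    exact (Metric.closure_ball_subset_closedBall.trans
      (Metric.closedBall_subset_closedBall (by linarith))).trans h4
  · rintro _ ⟨U, hU, hUne, hUC, ⟨c, -, -, -, hfin⟩, rfl⟩
    have hpos := hMeasure_pos ho hb hU hUne (subset_closure.trans hUC)
    have hle := main_ineq2 hc ho hb hne hδ hyp hU hUC
    have hlt : hMeasure C U < ⊤ := hle.trans_lt (ENNReal.mul_lt_top ENNReal.ofReal_lt_top hfin)
    have hp := ENNReal.toReal_pos hpos.ne' hlt.ne
    have := ENNReal.toReal_mono (ENNReal.mul_lt_top ENNReal.ofReal_lt_top hfin).ne hle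
    rw [ENNReal.toReal_mul, ENNReal.toReal_ofReal hK.le] at this
    rw [div_le_div_iff₀ hK hp]
    linarith

/-- if the Hilbert geometry of `C ⊆ ℝⁿ` is `δ`-hyperbolic, there is a
constant `I(δ) > 0` depending only on `δ` (and `n`) bounding from below the Cheeger
constant of every planar section of `C`. -/
theorem stmt13 {n : ℕ} (δ : ℝ) (hδ : 0 ≤ δ) :
    ∃ I : ℝ, 0 < I ∧ ∀ C : Set (Euc n), Convex ℝ C → IsOpen C →
      Bornology.IsBounded C → C.Nonempty → IsDeltaHyp C δ →
      ∀ φ : Euc 2 →ᵃⁱ[ℝ] Euc n, (φ ⁻¹' C).Nonempty → cheeger2 (φ ⁻¹' C) ≥ I := by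
  refine ⟨1 / Kc δ, one_div_pos.mpr (Kc_pos hδ), ?_⟩
  intro C hc ho hb _ hyp φ hne
  have hb2 : Bornology.IsBounded (φ ⁻¹' C) := by
    have := φ.isometry.antilipschitz.isBounded_preimage hb
    exact this
  exact cheeger_ge (hc.affine_preimage φ.toAffineMap) (ho.preimage φ.continuous) hb2 hne hδ
    (hyp_pre φ hyp)
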